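/- Let n ≥ 2 be an integer and d = 1 + n. There exist δ' > 0 and C > 0, depending only on n, such that for all dyadic integers N₁ ≥ N₂ ≥ 1 and all Fourier data g₁, g₂ : ℝ×ℤⁿ → ℂ with gⱼ supported in {κ : |κ| ≤ 2Nⱼ, and moreover |κ| ≥ Nⱼ/2 when Nⱼ > 1}, the free waves uⱼ = U₁ gⱼ on ℝ×𝕋ⁿ satisfy the local-in-time bilinear estimate ‖u₁ u₂‖_{L²([0,1]×ℝ×𝕋ⁿ)} ≤ C (1/N₂ + N₂/N₁)^{δ'} N₂^{(d−2)/2} ‖g₁‖_{L²} ‖g₂‖_{L²}. -/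

import Mathlib

noncomputable section
open MeasureTheory
open scoped ENNReal NNReal Classical

/-- `|k|` for `k = (ζ, j/λ) ∈ ℝ^m × (1/λ)ℤⁿ`. -/
def freqNorm (lam : ℝ) {m n : ℕ} (ζ : Fin m → ℝ) (j : Fin n → ℤ) : ℝ :=
  Real.sqrt ((∑ i, (ζ i) ^ 2) + ∑ i, ((j i : ℝ) / lam) ^ 2)

/-- The free Schrödinger wave `(U_λ g)(t, x, y) = ∫ g(k) e^{i(z·k − t|k|²)} (dk)_λ`
on `ℝ^m × 𝕋ⁿ_λ`, where `g ζ j` stands for `g (ζ, j/λ)`. -/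
def waveU (lam : ℝ) {m n : ℕ} (g : (Fin m → ℝ) → (Fin n → ℤ) → ℂ)
    (t : ℝ) (x : Fin m → ℝ) (y : Fin n → ℝ) : ℂ :=
  ((1 / lam ^ n : ℝ) : ℂ) * ∑' j : Fin n → ℤ, ∫ ζ : Fin m → ℝ,
    g ζ j * Complex.exp (Complex.I *
      ((((∑ i, x i * ζ i) + ∑ i, y i * ((j i : ℝ) / lam))
        - t * ((∑ i, (ζ i) ^ 2) + ∑ i, ((j i : ℝ) / lam) ^ 2) : ℝ) : ℂ))

/-- Squared `L²_λ` norm of Fourier data on `ℝ^m × (1/λ)ℤⁿ`. -/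
def l2sq (lam : ℝ) {m n : ℕ} (g : (Fin m → ℝ) → (Fin n → ℤ) → ℂ) : ℝ≥0∞ :=
  ENNReal.ofReal (1 / lam ^ n) * ∑' j : Fin n → ℤ, ∫⁻ ζ : Fin m → ℝ, (‖g ζ j‖₊ : ℝ≥0∞) ^ 2

/-- `N` is a dyadic integer, i.e. `N ∈ 2^ℕ`. -/
def IsDyadic (N : ℝ) : Prop := ∃ a : ℕ, N = 2 ^ a

/-- `g` is supported in `{k : |k| ≤ 2N, and moreover |k| ≥ N/2 when N > 1}`. -/
def SuppIn (lam : ℝ) {m n : ℕ} (g : (Fin m → ℝ) → (Fin n → ℤ) → ℂ) (N : ℝ) : Prop :=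
  ∀ ζ j, g ζ j ≠ 0 → freqNorm lam ζ j ≤ 2 * N ∧ (1 < N → N / 2 ≤ freqNorm lam ζ j)

/-- One period box of the torus `𝕋ⁿ_λ`. -/
def torusBox (lam : ℝ) (n : ℕ) : Set (Fin n → ℝ) :=
  Set.Icc 0 (fun _ => 2 * Real.pi * lam)


/-- majorant of the measure of `{w : σ - 2 ≤ w² ≤ σ}` -/
def Hc (σ : ℝ) : ℝ := if σ < 0 then 0 else 4 / √(max 1 σ)

lemma Hc_nonneg (σ : ℝ) : 0 ≤ Hc σ := by
  unfold Hc; split_ifs <;> positivity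

lemma Hc_neg {σ : ℝ} (h : σ < 0) : Hc σ = 0 := by simp [Hc, h]

lemma Hc_le_of_le {σ c : ℝ} (hc : 0 < c) (h : c ≤ σ) : Hc σ ≤ 4 / √c := by
  unfold Hc
  rw [if_neg (by linarith)]
  gcongr
  exact h.trans (le_max_right _ _)

lemma Hc_le_four (σ : ℝ) : Hc σ ≤ 4 := by
  unfold Hc
  split_ifs
  · norm_num
  · have : 1 ≤ √(max 1 σ) := by rw [Real.one_le_sqrt]; exact le_max_left _ _
    rw [div_le_iff₀ (by linarith)]; linarith

lemma vol_le_Hc (s : ℝ) :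
    volume {w : ℝ | s ≤ w ^ 2 ∧ w ^ 2 ≤ s + 2} ≤ ENNReal.ofReal (Hc (s + 2)) := by
  by_cases hs : s + 2 < 0
  · have : {w : ℝ | s ≤ w ^ 2 ∧ w ^ 2 ≤ s + 2} = ∅ := by
      ext w; simp only [Set.mem_ofPred_eq, Set.mem_empty_iff_false, iff_false]
      rintro ⟨_, h⟩; nlinarith [sq_nonneg w]
    rw [this]; simp
  · push Not at hs
    have hsub : {w : ℝ | s ≤ w ^ 2 ∧ w ^ 2 ≤ s + 2} ⊆
        Set.Icc (-√(s+2)) (-√s) ∪ Set.Icc (√s) (√(s+2)) := by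
      rintro w ⟨h1, h2⟩
      have a1 : √s ≤ |w| := by rw [← Real.sqrt_sq_eq_abs]; exact Real.sqrt_le_sqrt h1
      have a2 : |w| ≤ √(s+2) := by rw [← Real.sqrt_sq_eq_abs]; exact Real.sqrt_le_sqrt h2
      rcases le_total 0 w with hw | hw
      · rw [abs_of_nonneg hw] at a1 a2; right; exact ⟨a1, a2⟩
      · rw [abs_of_nonpos hw] at a1 a2; left; constructor <;> linarith
    refine (measure_mono hsub).trans ((measure_union_le _ _).trans ?_)
    rw [Real.volume_Icc, Real.volume_Icc]
    have hle : √s ≤ √(s+2) := Real.sqrt_le_sqrt (by linarith)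
    rw [← ENNReal.ofReal_add (by linarith) (by linarith)]
    apply ENNReal.ofReal_le_ofReal
    unfold Hc
    rw [if_neg (by linarith)]
    have hpos : 0 < √(max 1 (s+2)) := Real.sqrt_pos.mpr (lt_max_of_lt_left one_pos)
    rw [le_div_iff₀ hpos]
    have e1 := Real.sq_sqrt hs
    have n0 := Real.sqrt_nonneg s
    have n2 := Real.sqrt_nonneg (s+2)
    rcases le_total 0 s with h0 | h0
    · have e0 := Real.sq_sqrt h0
      rw [max_eq_right (by linarith)]
      nlinarith
    · have e0 : √s = 0 := Real.sqrt_eq_zero_of_nonpos h0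
      rw [e0]
      rcases le_total (s+2) 1 with h1 | h1
      · rw [max_eq_left h1, Real.sqrt_one]
        nlinarith
      · rw [max_eq_right h1]; nlinarith

lemma sum_inv_sqrt (m : ℕ) : ∑ i ∈ Finset.range m, 1 / √((i : ℝ) + 1) ≤ 2 * √(m : ℝ) := by
  induction m with
  | zero => simp
  | succ k ih =>
    rw [Finset.sum_range_succ]
    push_cast
    have h1 : 0 < √((k : ℝ) + 1) := Real.sqrt_pos.mpr (by positivity)
    have : 1 / √((k : ℝ) + 1) ≤ 2 * √((k : ℝ) + 1) - 2 * √(k : ℝ) := by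
      rw [div_le_iff₀ h1]
      have e1 := Real.sq_sqrt (show (0:ℝ) ≤ (k:ℝ)+1 by positivity)
      have e0 := Real.sq_sqrt (show (0:ℝ) ≤ (k:ℝ) by positivity)
      nlinarith [sq_nonneg (√((k : ℝ) + 1) - √(k : ℝ))]
    linarith

lemma one_d (s : Finset ℤ) (D q : ℝ) (m : ℕ) (J : ℤ) (hq : 0 < q) (hJ : (J : ℝ) ^ 2 ≤ D)
    (h : ∀ a ∈ s, (a : ℝ) ^ 2 ≤ D → a ≤ J ∧ (a < J → q ≤ J + a ∧ J - a ≤ m)) :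
    ∑ a ∈ s, Hc (D - (a : ℝ) ^ 2) ≤ Hc (D - (J : ℝ) ^ 2) + 8 * √(m / q) := by
  set f : ℤ → ℝ := fun a => Hc (D - (a : ℝ) ^ 2) with hf
  have hsplit : ∑ a ∈ s, f a ≤ f J + ∑ a ∈ s.filter (fun a : ℤ => a < J ∧ (a : ℝ) ^ 2 ≤ D), f a := by
    have : ∑ a ∈ s, f a = ∑ a ∈ s.filter (fun a : ℤ => (a : ℝ) ^ 2 ≤ D), f a := by
      symm
      apply Finset.sum_subset (Finset.filter_subset _ _)
      intro a ha hna
      apply Hc_neg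
      simp only [Finset.mem_filter, not_and, not_le] at hna
      linarith [hna ha]
    rw [this]
    have hsub : s.filter (fun a : ℤ => (a : ℝ) ^ 2 ≤ D) ⊆
        insert J (s.filter (fun a : ℤ => a < J ∧ (a : ℝ) ^ 2 ≤ D)) := by
      intro a ha
      simp only [Finset.mem_filter, Finset.mem_insert] at ha ⊢
      rcases (h a ha.1 ha.2).1.lt_or_eq with h1 | h1
      · right; exact ⟨ha.1, h1, ha.2⟩
      · left; exact h1
    refine (Finset.sum_le_sum_of_subset_of_nonneg hsub (fun i _ _ => Hc_nonneg _)).trans ?_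
    rw [Finset.sum_insert (by simp)]
  refine hsplit.trans ?_
  refine add_le_add le_rfl ?_
  have hsub : s.filter (fun a : ℤ => a < J ∧ (a : ℝ) ^ 2 ≤ D) ⊆
      ((Finset.range m).image (fun i : ℕ => J - 1 - (i : ℤ))) := by
    intro a ha
    simp only [Finset.mem_filter, Finset.mem_image, Finset.mem_range] at ha ⊢
    have := ((h a ha.1 ha.2.2).2 ha.2.1).2
    refine ⟨(J - 1 - a).toNat, ?_, ?_⟩ <;> omega
  have hterm : ∀ a ∈ s.filter (fun a : ℤ => a < J ∧ (a : ℝ) ^ 2 ≤ D),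
      f a ≤ 4 / √(((J : ℝ) - a) * q) := by
    intro a ha
    simp only [Finset.mem_filter] at ha
    have h1 := ((h a ha.1 ha.2.2).2 ha.2.1).1
    have h2 : (1 : ℝ) ≤ J - a := by exact_mod_cast (by omega : (1 : ℤ) ≤ J - a)
    apply Hc_le_of_le (by positivity)
    nlinarith
  refine (Finset.sum_le_sum hterm).trans ?_
  refine (Finset.sum_le_sum_of_subset_of_nonneg hsub (fun i _ _ => by positivity)).trans ?_
  rw [Finset.sum_image (by intro a _ b _ hab; simpa using hab)]
  have : ∀ i ∈ Finset.range m, 4 / √(((J : ℝ) - ((J - 1 - (i : ℤ) : ℤ) : ℝ)) * q)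
      = (4 / √q) * (1 / √((i : ℝ) + 1)) := by
    intro i _
    push_cast
    rw [show ((J : ℝ) - (J - 1 - i)) = (i : ℝ) + 1 by ring, Real.sqrt_mul (by positivity)]
    field_simp
  rw [Finset.sum_congr rfl this, ← Finset.mul_sum]
  calc _ ≤ (4 / √q) * (2 * √(m : ℝ)) := by gcongr; exact sum_inv_sqrt m
    _ = _ := by rw [Real.sqrt_div (by positivity)]; ring

lemma one_d_nonneg (s : Finset ℤ) (hs : ∀ a ∈ s, 0 ≤ a) (D : ℝ) :
    ∑ a ∈ s, Hc (D - (a : ℝ) ^ 2) ≤ 12 := by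
  by_cases hD : D < 0
  · rw [Finset.sum_eq_zero]
    · norm_num
    · intro a _; apply Hc_neg; nlinarith [sq_nonneg (a : ℝ)]
  push Not at hD
  have hJ0 : 0 ≤ ⌊√D⌋ := Int.floor_nonneg.mpr (Real.sqrt_nonneg _)
  have hJ1 := Int.floor_le (√D)
  set J := ⌊√D⌋ with hJ
  have hJ0' : (0 : ℝ) ≤ J := by exact_mod_cast hJ0
  have hJD : (J : ℝ) ^ 2 ≤ D := by
    nlinarith [Real.sq_sqrt hD]
  have key : ∀ a ∈ s, (a : ℝ) ^ 2 ≤ D → a ≤ J := by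
    intro a ha h
    apply Int.le_floor.mpr
    exact Real.le_sqrt_of_sq_le h
  rcases hJ0.lt_or_eq with hpos | hzero
  · have hpos' : (0 : ℝ) < J := by exact_mod_cast hpos
    have := one_d s D J J.toNat J hpos' hJD (by
      intro a ha h
      refine ⟨key a ha h, fun _ => ⟨?_, ?_⟩⟩
      · have : (0 : ℝ) ≤ a := by exact_mod_cast hs a ha
        linarith
      · have := hs a ha; omega)
    have e : ((J.toNat : ℕ) : ℝ) = J := by
      exact_mod_cast Int.toNat_of_nonneg hJ0
    rw [e, div_self hpos'.ne', Real.sqrt_one] at this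
    linarith [Hc_le_four (D - (J : ℝ) ^ 2)]
  · have := one_d s D 1 0 J one_pos hJD (by
      intro a ha h
      refine ⟨key a ha h, fun h' => ?_⟩
      have := hs a ha; omega)
    simp at this
    linarith [Hc_le_four (D - (J : ℝ) ^ 2)]

lemma one_d_all (s : Finset ℤ) (D : ℝ) :
    ∑ a ∈ s, Hc (D - (a : ℝ) ^ 2) ≤ 24 := by
  rw [← Finset.sum_filter_add_sum_filter_not s (fun a => 0 ≤ a)]
  have h1 := one_d_nonneg (s.filter (fun a => 0 ≤ a)) (by simp) D
  have h2 := one_d_nonneg ((s.filter (fun a => ¬ 0 ≤ a)).image (fun a => -a)) (by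
    intro a ha
    simp only [Finset.mem_image, Finset.mem_filter] at ha
    obtain ⟨b, hb, rfl⟩ := ha; omega) D
  rw [Finset.sum_image (by intro a _ b _ hab; simpa using hab)] at h2
  simp only [Int.cast_neg, neg_sq] at h2
  linarith

lemma pt_diff (a a' b b' B K L c N : ℝ) (hc : 0 < c) (hN : 0 < N) (hL : 1 ≤ L)
    (hKN : K ≤ N) (ha : c * N ≤ a) (ha' : c * N ≤ a') (hb : |b| ≤ 8 * N) (hb' : |b'| ≤ 8 * N)
    (h0 : 0 ≤ b' - b) (hl : b' - b ≤ L)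
    (p : 0 ≤ B - a ^ 2 - b ^ 2) (q : B - a ^ 2 - b ^ 2 ≤ K)
    (p' : 0 ≤ B - a' ^ 2 - b' ^ 2) (q' : B - a' ^ 2 - b' ^ 2 ≤ K) :
    |a' - a| * c ≤ 9 * L := by
  have hcN : 0 < c * N := by positivity
  rw [abs_le] at hb hb'
  have e2 : |b' ^ 2 - b ^ 2| ≤ 16 * N * L := by
    rw [show b' ^ 2 - b ^ 2 = (b' - b) * (b' + b) by ring, abs_mul, abs_of_nonneg h0]
    calc (b' - b) * |b' + b| ≤ L * (16 * N) := by
          gcongr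
          rw [abs_le]; constructor <;> linarith
      _ = _ := by ring
  rw [abs_le] at e2
  have e1 : |a' - a| * (a' + a) ≤ 16 * N * L + K := by
    have hs : (0 : ℝ) ≤ a' + a := by linarith
    rw [← abs_of_nonneg hs, ← abs_mul, show (a' - a) * (a' + a) = a' ^ 2 - a ^ 2 by ring, abs_le]
    constructor <;> linarith
  have h0' := abs_nonneg (a' - a)
  have e3 : |a' - a| * (2 * (c * N)) ≤ |a' - a| * (a' + a) := by
    gcongr; linarith
  have e4 : N ≤ N * L := by nlinarith
  have : |a' - a| * c * (2 * N) ≤ (9 * L) * (2 * N) := by nlinarith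
  exact le_of_mul_le_mul_right this (by positivity)

lemma pt_inner (a1 b1 x y K L c : ℝ) (hc : 0 < c) (hc1 : c ≤ 1) (hL : 1 ≤ L)
    (hK : K ≤ L) (hK0 : 0 ≤ K) (hy : 0 ≤ y) (hyL : y ≤ L) (hx : |x| * c ≤ 9 * L)
    (hxy : |2 * (a1 * x + b1 * y) + x ^ 2 + y ^ 2| ≤ K) :
    |a1 * x + b1 * y| * c ^ 2 ≤ 42 * L ^ 2 := by
  have hs : x ^ 2 * c ^ 2 ≤ 81 * L ^ 2 := by
    have : (|x| * c) ^ 2 ≤ (9 * L) ^ 2 := by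
      apply pow_le_pow_left₀ _ hx
      have := abs_nonneg x; positivity
    rw [mul_pow, sq_abs] at this; linarith
  have hy2 : y ^ 2 ≤ L ^ 2 := pow_le_pow_left₀ hy hyL 2
  have hc2 : c ^ 2 ≤ 1 := pow_le_one₀ hc.le hc1
  have hc20 : 0 < c ^ 2 := by positivity
  have hLL : L ≤ L ^ 2 := by nlinarith
  have t : |2 * (a1 * x + b1 * y)| ≤ K + x ^ 2 + y ^ 2 := by
    have p1 := sq_nonneg x
    have p2 := sq_nonneg y
    rw [abs_le] at hxy ⊢
    constructor <;> linarith
  rw [abs_mul, abs_two] at t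
  have h1 : 2 * |a1 * x + b1 * y| * c ^ 2 ≤ (K + x ^ 2 + y ^ 2) * c ^ 2 := by gcongr
  have h2 : (K + y ^ 2) * c ^ 2 ≤ (L ^ 2 + L ^ 2) * 1 := by
    gcongr; linarith
  linarith

lemma pt_det (a1 b1 u1 u2 v1 v2 K L c N : ℝ) (hc : 0 < c) (hc1 : c ≤ 1) (hL : 1 ≤ L)
    (hK : K ≤ L) (hK0 : 0 ≤ K) (hLN : 1000 * L ^ 3 < c ^ 3 * N) (ha1 : c * N ≤ a1) (hN : 0 < N)
    (u20 : 0 ≤ u2) (u2L : u2 ≤ L) (v20 : 0 ≤ v2) (v2L : v2 ≤ L)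
    (d2 : |u1| * c ≤ 9 * L) (d3 : |v1| * c ≤ 9 * L)
    (hu : |2 * (a1 * u1 + b1 * u2) + u1 ^ 2 + u2 ^ 2| ≤ K)
    (hv : |2 * (a1 * v1 + b1 * v2) + v1 ^ 2 + v2 ^ 2| ≤ K)
    (h1 : 1 ≤ |u1 * v2 - v1 * u2|) : False := by
  have hcN : 0 < c * N := by positivity
  have hid : a1 * (u1 * v2 - v1 * u2) = (a1 * u1 + b1 * u2) * v2 - (a1 * v1 + b1 * v2) * u2 := by
    ring
  have i1 := pt_inner a1 b1 u1 u2 K L c hc hc1 hL hK hK0 u20 u2L d2 hu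
  have i2 := pt_inner a1 b1 v1 v2 K L c hc hc1 hL hK hK0 v20 v2L d3 hv
  have t1 : a1 * |u1 * v2 - v1 * u2| ≤ |a1 * u1 + b1 * u2| * v2 + |a1 * v1 + b1 * v2| * u2 := by
    have : a1 * |u1 * v2 - v1 * u2| = |a1 * (u1 * v2 - v1 * u2)| := by
      rw [abs_mul, abs_of_nonneg (show (0 : ℝ) ≤ a1 by linarith)]
    rw [this, hid]
    refine (abs_sub _ _).trans ?_
    rw [abs_mul, abs_mul, abs_of_nonneg u20, abs_of_nonneg v20]
  have t2 : c * N ≤ |a1 * u1 + b1 * u2| * v2 + |a1 * v1 + b1 * v2| * u2 := by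
    refine le_trans ?_ t1
    calc c * N ≤ a1 * 1 := by linarith
      _ ≤ _ := by gcongr; linarith
  have t3 : c ^ 2 * (c * N) ≤ 84 * L ^ 3 := by
    calc c ^ 2 * (c * N) ≤ c ^ 2 * (|a1 * u1 + b1 * u2| * v2 + |a1 * v1 + b1 * v2| * u2) := by gcongr
      _ = (|a1 * u1 + b1 * u2| * c ^ 2) * v2 + (|a1 * v1 + b1 * v2| * c ^ 2) * u2 := by ring
      _ ≤ (42 * L ^ 2) * L + (42 * L ^ 2) * L := by gcongr
      _ = 84 * L ^ 3 := by ring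
  have t4 := pow_pos (show 0 < L by linarith) 3
  have t5 : c ^ 2 * (c * N) = c ^ 3 * N := by ring
  linarith

lemma pt_col (a1 b1 u1 u2 v1 v2 K f1 f2 f3 D0 : ℝ) (hD : K ≤ D0 ^ 2) (hD0 : 0 ≤ D0)
    (hu2 : D0 < u2) (hw : D0 < v2 - u2) (hdet : u1 * v2 = v1 * u2)
    (e2 : f2 - f1 = 2 * (a1 * u1 + b1 * u2) + u1 ^ 2 + u2 ^ 2)
    (e3 : f3 - f1 = 2 * (a1 * v1 + b1 * v2) + v1 ^ 2 + v2 ^ 2)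
    (h12 : -K ≤ f2 - f1) (h23 : f3 - f2 ≤ K) : False := by
  have hu2p : 0 < u2 := by linarith
  have hwp : 0 < v2 - u2 := by linarith
  have hv2p : 0 < v2 := by linarith
  have F1 : u2 * (f3 - f2) + (v2 - u2) * (-(f2 - f1)) ≤ u2 * K + (v2 - u2) * K := by
    gcongr; linarith
  have F2 : u2 * (f3 - f2) + (v2 - u2) * (-(f2 - f1))
      = u2 * v1 ^ 2 - v2 * u1 ^ 2 + u2 * v2 * (v2 - u2) := by
    linear_combination u2 * e3 - v2 * e2 - 2 * a1 * hdet
  have F3 : 0 ≤ u2 * v1 ^ 2 - v2 * u1 ^ 2 := by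
    have : u2 * (u2 * v1 ^ 2 - v2 * u1 ^ 2) = u1 ^ 2 * v2 * (v2 - u2) := by
      have : u2 * (u2 * v1 ^ 2) = (u1 * v2) ^ 2 := by rw [hdet]; ring
      linear_combination this
    have h0 : 0 ≤ u2 * (u2 * v1 ^ 2 - v2 * u1 ^ 2) := by
      rw [this]; positivity
    exact nonneg_of_mul_nonneg_right h0 hu2p
  have F5 : u2 * (v2 - u2) ≤ K := by
    have : v2 * (u2 * (v2 - u2)) ≤ v2 * K := by linarith
    exact le_of_mul_le_mul_left this hv2p
  have : D0 * D0 < u2 * (v2 - u2) := mul_lt_mul'' hu2 hw hD0 hD0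
  nlinarith

/-- three-point lemma -/
lemma three_pt (a1 a2 a3 b1 b2 b3 : ℤ) (B K L c N D0 : ℝ) (hc : 0 < c) (hc1 : c ≤ 1) (hN : 0 < N) (hL : 1 ≤ L)
    (hK0 : 0 ≤ K) (hK : K ≤ L) (hD : K ≤ D0 ^ 2) (hD0 : 0 ≤ D0)
    (hLN : 1000 * L ^ 3 < c ^ 3 * N)
    (ha1 : c * N ≤ a1) (ha2 : c * N ≤ a2) (ha3 : c * N ≤ a3)
    (hb1 : |(b1 : ℝ)| ≤ 8 * N) (hb2 : |(b2 : ℝ)| ≤ 8 * N) (hb3 : |(b3 : ℝ)| ≤ 8 * N)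
    (h12 : D0 < b2 - b1) (h23 : D0 < b3 - b2) (h13 : (b3 : ℝ) - b1 ≤ L)
    (p1 : 0 ≤ B - a1 ^ 2 - b1 ^ 2) (q1 : B - a1 ^ 2 - b1 ^ 2 ≤ K)
    (p2 : 0 ≤ B - a2 ^ 2 - b2 ^ 2) (q2 : B - a2 ^ 2 - b2 ^ 2 ≤ K)
    (p3 : 0 ≤ B - a3 ^ 2 - b3 ^ 2) (q3 : B - a3 ^ 2 - b3 ^ 2 ≤ K) : False := by
  have hN1 : K ≤ N := by
    have h1 : c ^ 3 * N ≤ 1 * N := by gcongr; exact pow_le_one₀ hc.le hc1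
    have h2 : L ≤ L ^ 3 := le_self_pow₀ hL (by norm_num)
    linarith
  have d2 := pt_diff a1 a2 b1 b2 B K L c N hc hN hL hN1 ha1 ha2 hb1 hb2 (by linarith) (by linarith) p1 q1 p2 q2
  have d3 := pt_diff a1 a3 b1 b3 B K L c N hc hN hL hN1 ha1 ha3 hb1 hb3 (by linarith) (by linarith) p1 q1 p3 q3
  have e2 : ((a2:ℝ)^2 + b2^2) - (a1^2+b1^2) = 2 * (a1 * ((a2:ℝ)-a1) + b1 * (b2-b1)) + ((a2:ℝ)-a1) ^ 2 + (b2-b1) ^ 2 := by ring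
  have e3 : ((a3:ℝ)^2 + b3^2) - (a1^2+b1^2) = 2 * (a1 * ((a3:ℝ)-a1) + b1 * (b3-b1)) + ((a3:ℝ)-a1) ^ 2 + (b3-b1) ^ 2 := by ring
  by_cases hdet : (a2 - a1) * (b3 - b1) - (a3 - a1) * (b2 - b1) = (0 : ℤ)
  · have hdet' : ((a2 - a1) * (b3 - b1) : ℝ) - (a3 - a1) * (b2 - b1) = 0 := by exact_mod_cast hdet
    exact pt_col a1 b1 (a2-a1) (b2-b1) (a3-a1) (b3-b1) K _ _ _ D0 hD hD0 h12 (by linarith)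
      (by linarith) e2 e3 (by linarith) (by linarith)
  · have h1 : (1 : ℝ) ≤ |((a2:ℝ)-a1) * (b3-b1) - (a3-a1) * (b2-b1)| := by
      have := Int.one_le_abs hdet
      exact_mod_cast this
    exact pt_det a1 b1 (a2-a1) (b2-b1) (a3-a1) (b3-b1) K L c N hc hc1 hL hK hK0 hLN ha1 hN
      (by linarith) (by linarith) (by linarith) h13 d2 d3
      (by rw [← e2, abs_le]; constructor <;> linarith)
      (by rw [← e3, abs_le]; constructor <;> linarith) h1



lemma two_cluster (s : Finset ℤ) (D : ℕ)
    (h : ∀ x ∈ s, ∀ y ∈ s, ∀ z ∈ s, (D : ℤ) < y - x → (D : ℤ) < z - y → False) :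
    s.card ≤ 2 * (D + 1) := by
  rcases s.eq_empty_or_nonempty with rfl | hne
  · simp
  have hx := s.min'_mem hne
  have hxm := fun b hb => s.min'_le b hb
  set x := s.min' hne
  have h1 : (s.filter (fun b => b ≤ x + D)).card ≤ D + 1 := by
    have : s.filter (fun b => b ≤ x + D) ⊆ Finset.Icc x (x + D) := by
      intro b hb
      simp only [Finset.mem_filter, Finset.mem_Icc] at hb ⊢
      exact ⟨hxm b hb.1, hb.2⟩
    refine (Finset.card_le_card this).trans ?_
    rw [Int.card_Icc]; omega
  have h2 : (s.filter (fun b => ¬ b ≤ x + D)).card ≤ D + 1 := by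
    rcases (s.filter (fun b => ¬ b ≤ x + D)).eq_empty_or_nonempty with he | hne2
    · rw [he]; simp
    have hy := Finset.min'_mem _ hne2
    have hym := fun b hb => Finset.min'_le (s.filter (fun b => ¬ b ≤ x + D)) b hb
    set y := (s.filter (fun b => ¬ b ≤ x + D)).min' hne2
    rw [Finset.mem_filter] at hy
    have : s.filter (fun b => ¬ b ≤ x + D) ⊆ Finset.Icc y (y + D) := by
      intro b hb
      have := hym b hb
      simp only [Finset.mem_filter, Finset.mem_Icc] at hb ⊢
      refine ⟨this, ?_⟩
      by_contra hcon
      exact h x hx y hy.1 b hb.1 (by omega) (by omega)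
    refine (Finset.card_le_card this).trans ?_
    rw [Int.card_Icc]; omega
  have := Finset.card_filter_add_card_filter_not (s := s) (fun b => b ≤ x + D)
  omega

lemma window_count (s : Finset ℤ) (lo : ℤ) (m L M : ℕ) (hL : 0 < L)
    (hs : ∀ b ∈ s, lo ≤ b ∧ b ≤ lo + m)
    (hw : ∀ t ⊆ s, (∀ b ∈ t, ∀ b' ∈ t, b - b' ≤ L) → t.card ≤ M) :
    s.card ≤ M * (m / L + 1) := by
  have := Finset.card_le_mul_card_image_of_maps_to (s := s) (t := Finset.range (m / L + 1))
    (f := fun b => ((b - lo).toNat / L)) (by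
      intro b hb
      have := hs b hb
      rw [Finset.mem_range]
      have h1 : (b - lo).toNat ≤ m := by omega
      have := Nat.div_le_div_right (c := L) h1
      omega) M (by
      intro k _
      apply hw _ (Finset.filter_subset _ _)
      intro b hb b' hb'
      simp only [Finset.mem_filter] at hb hb'
      have h1 := hs b hb.1
      have h2 := hs b' hb'.1
      have e1 := Nat.div_add_mod (b - lo).toNat L
      have e2 := Nat.div_add_mod (b' - lo).toNat L
      rw [hb.2] at e1
      rw [hb'.2] at e2
      have l1 := Nat.mod_lt (b - lo).toNat hL
      have : (b - lo).toNat ≤ (b' - lo).toNat + L := by omega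
      omega)
  simpa using this

lemma bad_count (I Iq : Finset ℤ) (lo : ℤ) (m L : ℕ) (B c N : ℝ) (hc : 0 < c) (hc1 : c ≤ 1)
    (hN : 0 < N) (hL : 1 ≤ L) (hLm : L ≤ m) (hLN : 1000 * (L : ℝ) ^ 3 < c ^ 3 * N)
    (hI : ∀ a ∈ I, c * N ≤ a) (hq : ∀ b ∈ Iq, lo ≤ b ∧ b ≤ lo + m)
    (hqb : ∀ b ∈ Iq, |(b : ℝ)| ≤ 8 * N) :
    ((Iq.filter (fun b : ℤ => ∃ a ∈ I, 0 ≤ B - (a : ℝ) ^ 2 - (b : ℝ) ^ 2 ∧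
      B - (a : ℝ) ^ 2 - (b : ℝ) ^ 2 ≤ L)).card : ℝ) ≤ 12 * m / √L := by
  have hL' : (1 : ℝ) ≤ L := by exact_mod_cast hL
  have hD := Nat.sqrt_lt'.mp (Nat.lt_succ_self (Nat.sqrt L))
  have hcard := window_count (Iq.filter (fun b : ℤ => ∃ a ∈ I, 0 ≤ B - (a : ℝ) ^ 2 - (b : ℝ) ^ 2 ∧
      B - (a : ℝ) ^ 2 - (b : ℝ) ^ 2 ≤ L)) lo m L (2 * (Nat.sqrt L + 1 + 1)) hL
    (fun b hb => hq b (Finset.mem_filter.mp hb).1) (by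
      intro t ht htL
      apply two_cluster
      intro x hx y hy z hz hxy hyz
      obtain ⟨hx1, a1, ha1, p1, q1⟩ := Finset.mem_filter.mp (ht hx)
      obtain ⟨hy1, a2, ha2, p2, q2⟩ := Finset.mem_filter.mp (ht hy)
      obtain ⟨hz1, a3, ha3, p3, q3⟩ := Finset.mem_filter.mp (ht hz)
      refine three_pt a1 a2 a3 x y z B L L c N ((Nat.sqrt L + 1 : ℕ) : ℝ) hc hc1 hN hL' (by positivity)
        le_rfl ?_ (by positivity) hLN (hI _ ha1) (hI _ ha2) (hI _ ha3) (hqb _ hx1) (hqb _ hy1)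
        (hqb _ hz1) ?_ ?_ ?_ p1 q1 p2 q2 p3 q3
      · exact_mod_cast hD.le
      · exact_mod_cast hxy
      · exact_mod_cast hyz
      · exact_mod_cast htL z hz x hx)
  have hcard' : ((Iq.filter (fun b : ℤ => ∃ a ∈ I, 0 ≤ B - (a : ℝ) ^ 2 - (b : ℝ) ^ 2 ∧
      B - (a : ℝ) ^ 2 - (b : ℝ) ^ 2 ≤ L)).card : ℝ) ≤
      (2 * ((Nat.sqrt L : ℝ) + 1 + 1)) * (((m / L : ℕ) : ℝ) + 1) := by exact_mod_cast hcard
  refine hcard'.trans ?_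
  have h1 : (Nat.sqrt L : ℝ) ≤ √L := Real.nat_sqrt_le_real_sqrt
  have h2 : 1 ≤ √(L : ℝ) := Real.one_le_sqrt.mpr hL'
  have h3 : ((m / L : ℕ) : ℝ) ≤ (m : ℝ) / L := Nat.cast_div_le
  have h4 : (1 : ℝ) ≤ m / L := by
    rw [le_div_iff₀ (by linarith)]; exact_mod_cast (by omega : 1 * L ≤ m)
  calc (2 * ((Nat.sqrt L : ℝ) + 1 + 1)) * (((m / L : ℕ) : ℝ) + 1)
      ≤ (2 * (√L + √L + √L)) * ((m : ℝ) / L + m / L) := by gcongr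
    _ = 12 * m * (√L / L) := by ring
    _ = 12 * m / √L := by rw [Real.sqrt_div_self']; ring

lemma two_d_pos (I Iq : Finset ℤ) (lo : ℤ) (m L : ℕ) (B c N : ℝ) (hc : 0 < c) (hc1 : c ≤ 1)
    (hN : 0 < N) (hL : 1 ≤ L) (hLm : L ≤ m) (hLN : 1000 * (L : ℝ) ^ 3 < c ^ 3 * N)
    (hI : ∀ a ∈ I, c * N ≤ a) (hIm : ∀ a ∈ I, ∀ a' ∈ I, a - a' ≤ m)
    (hq : ∀ b ∈ Iq, lo ≤ b ∧ b ≤ lo + m)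
    (hqb : ∀ b ∈ Iq, |(b : ℝ)| ≤ 8 * N) :
    ∑ b ∈ Iq, ∑ a ∈ I, Hc (B - (b : ℝ) ^ 2 - (a : ℝ) ^ 2) ≤
      m * (56 / √L + 16 * √(m / (c * N))) := by
  have hL' : (1 : ℝ) ≤ L := by exact_mod_cast hL
  have hm' : (1 : ℝ) ≤ m := by exact_mod_cast hL.trans hLm
  have hbad := bad_count I Iq lo m L B c N hc hc1 hN hL hLm hLN hI hq hqb
  have hcN : 0 < c * N := by positivity
  have hone : ∀ b ∈ Iq, ∑ a ∈ I, Hc (B - (b : ℝ) ^ 2 - (a : ℝ) ^ 2) ≤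
      (if (∃ a ∈ I, 0 ≤ B - (a : ℝ) ^ 2 - (b : ℝ) ^ 2 ∧
      B - (a : ℝ) ^ 2 - (b : ℝ) ^ 2 ≤ L) then 4 else 0) + (4 / √L + 8 * √(m / (c * N))) := by
    intro b _
    have hrhs : 0 ≤ (if (∃ a ∈ I, 0 ≤ B - (a : ℝ) ^ 2 - (b : ℝ) ^ 2 ∧
      B - (a : ℝ) ^ 2 - (b : ℝ) ^ 2 ≤ L) then (4 : ℝ) else 0) := by split_ifs <;> norm_num
    set D := B - (b : ℝ) ^ 2 with hD
    rcases (I.filter (fun a : ℤ => (a : ℝ) ^ 2 ≤ D)).eq_empty_or_nonempty with he | hne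
    · rw [Finset.sum_eq_zero]
      · positivity
      · intro a ha
        apply Hc_neg
        have := Finset.filter_eq_empty_iff.mp he ha
        push Not at this; linarith
    have hJ := Finset.max'_mem _ hne
    have hJm := fun a ha => Finset.le_max' (I.filter (fun a : ℤ => (a : ℝ) ^ 2 ≤ D)) a ha
    set J := (I.filter (fun a : ℤ => (a : ℝ) ^ 2 ≤ D)).max' hne
    rw [Finset.mem_filter] at hJ
    have := one_d I D (c * N) m J hcN hJ.2 (by
      intro a ha h
      refine ⟨hJm a (Finset.mem_filter.mpr ⟨ha, h⟩), fun _ => ⟨?_, ?_⟩⟩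
      · linarith [hI a ha, hI J hJ.1]
      · exact hIm J hJ.1 a ha)
    refine this.trans ?_
    rw [← add_assoc]
    gcongr
    split_ifs with hex
    · exact (Hc_le_four _).trans (le_add_of_nonneg_right (by positivity))
    · rw [zero_add]
      apply Hc_le_of_le (by linarith)
      by_contra hlt
      push Not at hlt
      exact hex ⟨J, hJ.1, by linarith [hJ.2], by linarith⟩
  refine (Finset.sum_le_sum hone).trans ?_
  rw [Finset.sum_add_distrib, Finset.sum_const, ← Finset.sum_filter, Finset.sum_const]
  simp only [nsmul_eq_mul]
  have hcardq : (Iq.card : ℝ) ≤ m + 1 := by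
    have : Iq ⊆ Finset.Icc lo (lo + m) := by
      intro b hb; rw [Finset.mem_Icc]; exact hq b hb
    have := Finset.card_le_card this
    rw [Int.card_Icc] at this
    exact_mod_cast (by omega : Iq.card ≤ m + 1)
  calc _ ≤ (12 * m / √L) * 4 + (m + m) * (4 / √L + 8 * √(m / (c * N))) := by
        gcongr; linarith
    _ = _ := by ring

lemma two_d_abs (I Iq : Finset ℤ) (lo : ℤ) (m L : ℕ) (B c N : ℝ) (hc : 0 < c) (hc1 : c ≤ 1)
    (hN : 0 < N) (hL : 1 ≤ L) (hLm : L ≤ m) (hLN : 1000 * (L : ℝ) ^ 3 < c ^ 3 * N)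
    (hI : ∀ a ∈ I, c * N ≤ |(a : ℝ)|) (hIm : ∀ a ∈ I, ∀ a' ∈ I, a - a' ≤ m)
    (hq : ∀ b ∈ Iq, lo ≤ b ∧ b ≤ lo + m)
    (hqb : ∀ b ∈ Iq, |(b : ℝ)| ≤ 8 * N) :
    ∑ b ∈ Iq, ∑ a ∈ I, Hc (B - (b : ℝ) ^ 2 - (a : ℝ) ^ 2) ≤
      2 * (m * (56 / √L + 16 * √(m / (c * N)))) := by
  have h1 := two_d_pos (I.filter (fun a => 0 ≤ a)) Iq lo m L B c N hc hc1 hN hL hLm hLN (by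
    intro a ha
    rw [Finset.mem_filter] at ha
    have := hI a ha.1
    rwa [abs_of_nonneg (by exact_mod_cast ha.2)] at this)
    (fun a ha a' ha' => hIm a (Finset.mem_filter.mp ha).1 a' (Finset.mem_filter.mp ha').1) hq hqb
  have h2 := two_d_pos ((I.filter (fun a => ¬ 0 ≤ a)).image (fun a => -a)) Iq lo m L B c N hc hc1 hN hL hLm hLN (by
    intro a ha
    simp only [Finset.mem_image, Finset.mem_filter] at ha
    obtain ⟨x, hx, rfl⟩ := ha
    have := hI x hx.1
    rw [abs_of_neg (by exact_mod_cast (by omega : x < 0))] at this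
    push_cast; exact this)
    (by
      intro a ha a' ha'
      simp only [Finset.mem_image, Finset.mem_filter] at ha ha'
      obtain ⟨x, hx, rfl⟩ := ha
      obtain ⟨x', hx', rfl⟩ := ha'
      have := hIm x' hx'.1 x hx.1
      omega) hq hqb
  have e : ∀ b ∈ Iq, ∑ a ∈ I, Hc (B - (b : ℝ) ^ 2 - (a : ℝ) ^ 2) =
      ∑ a ∈ (I.filter (fun a => 0 ≤ a)), Hc (B - (b : ℝ) ^ 2 - (a : ℝ) ^ 2) +
      ∑ a ∈ ((I.filter (fun a => ¬ 0 ≤ a)).image (fun a => -a)), Hc (B - (b : ℝ) ^ 2 - (a : ℝ) ^ 2) := by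
    intro b _
    rw [Finset.sum_image (by intro a _ b _ hab; simpa using hab)]
    simp only [Int.cast_neg, neg_sq]
    rw [Finset.sum_filter_add_sum_filter_not]
  rw [Finset.sum_congr rfl e, Finset.sum_add_distrib]
  linarith

/-- the gain factor -/
def Eg (N₁ N₂ : ℝ) : ℝ := (1 / N₂ + N₂ / N₁) ^ (1 / 6 : ℝ)

lemma Eg_pos {N₁ N₂ : ℝ} (h2 : 1 ≤ N₂) (h : N₂ ≤ N₁) : 0 < Eg N₁ N₂ := by
  unfold Eg
  have : 0 < N₂ := by linarith
  have : 0 < N₁ := by linarith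
  positivity

lemma Eg_ge1 {N₁ N₂ : ℝ} (h2 : 1 ≤ N₂) (h : N₂ ≤ N₁) : N₂ ^ (-(1 / 6) : ℝ) ≤ Eg N₁ N₂ := by
  unfold Eg
  have h2' : 0 < N₂ := by linarith
  have h1' : 0 < N₁ := by linarith
  rw [Real.rpow_neg h2'.le, ← Real.inv_rpow h2'.le]
  apply Real.rpow_le_rpow (by positivity) _ (by norm_num)
  rw [one_div]
  exact le_add_of_nonneg_right (by positivity)

lemma Eg_ge2 {N₁ N₂ : ℝ} (h2 : 1 ≤ N₂) (h : N₂ ≤ N₁) : √(N₂ / N₁) ≤ Eg N₁ N₂ := by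
  unfold Eg
  have h2' : 0 < N₂ := by linarith
  have h1' : 0 < N₁ := by linarith
  rw [Real.sqrt_eq_rpow]
  calc (N₂ / N₁) ^ (1 / 2 : ℝ) ≤ (N₂ / N₁) ^ (1 / 6 : ℝ) := by
        apply Real.rpow_le_rpow_of_exponent_ge (by positivity) _ (by norm_num)
        rw [div_le_one h1']; exact h
    _ ≤ _ := by
      apply Real.rpow_le_rpow (by positivity) _ (by norm_num)
      exact le_add_of_nonneg_left (by positivity)

lemma Eg_ge3 {N₁ N₂ : ℝ} (h2 : 1 ≤ N₂) (h : N₂ ≤ N₁) : N₂ / N₁ ≤ Eg N₁ N₂ := by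
  refine le_trans ?_ (Eg_ge2 h2 h)
  have h2' : 0 < N₂ := by linarith
  have h1' : 0 < N₁ := by linarith
  apply Real.le_sqrt_of_sq_le
  have : N₂ / N₁ ≤ 1 := by rw [div_le_one h1']; exact h
  have : 0 < N₂ / N₁ := by positivity
  nlinarith

lemma two_d_trivial (I Iq : Finset ℤ) (B : ℝ) (lo : ℤ) (m : ℕ) (hq : ∀ b ∈ Iq, lo ≤ b ∧ b ≤ lo + m) :
    ∑ b ∈ Iq, ∑ a ∈ I, Hc (B - (b : ℝ) ^ 2 - (a : ℝ) ^ 2) ≤ 24 * (m + 1) := by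
  have hcardq : (Iq.card : ℝ) ≤ m + 1 := by
    have : Iq ⊆ Finset.Icc lo (lo + m) := by
      intro b hb; rw [Finset.mem_Icc]; exact hq b hb
    have := Finset.card_le_card this
    rw [Int.card_Icc] at this
    exact_mod_cast (by omega : Iq.card ≤ m + 1)
  refine (Finset.sum_le_sum (fun b _ => one_d_all I _)).trans ?_
  simp only [Finset.sum_const, nsmul_eq_mul]
  linarith

lemma two_d_gain (c : ℝ) (hc : 0 < c) (hc1 : c ≤ 1) : ∃ C : ℝ, 0 < C ∧
    ∀ (I Iq : Finset ℤ) (lo : ℤ) (M : ℕ) (B N : ℝ), 1 ≤ M → (M : ℝ) ≤ N →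
    (∀ a ∈ I, c * N ≤ |(a : ℝ)|) → (∀ a ∈ I, ∀ a' ∈ I, a - a' ≤ (8 * M : ℕ)) →
    (∀ b ∈ Iq, lo ≤ b ∧ b ≤ lo + (8 * M : ℕ)) → (∀ b ∈ Iq, |(b : ℝ)| ≤ 8 * N) →
    ∑ b ∈ Iq, ∑ a ∈ I, Hc (B - (b : ℝ) ^ 2 - (a : ℝ) ^ 2) ≤ C * M * Eg N M := by
  set C1 : ℝ := 216 / (c / 20) with hC1
  set C2 : ℝ := 896 / √(c / 40) + 256 * √(8 / c) with hC2
  refine ⟨C1 + C2, by positivity, ?_⟩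
  intro I Iq lo M B N hM hMN hI hIm hq hqb
  have hM' : (1 : ℝ) ≤ M := by exact_mod_cast hM
  have hE := Eg_pos hM' hMN
  have hE1 := Eg_ge1 hM' hMN
  have hE2 := Eg_ge2 hM' hMN
  have hN : 0 < N := by linarith
  have hMp : (0 : ℝ) < M := by linarith
  set R : ℝ := c / 20 * (M : ℝ) ^ (1 / 3 : ℝ) with hR
  have hMpow : (M : ℝ) ^ (-(1/6) : ℝ) * (M : ℝ) ^ (1/3 : ℝ) = (M : ℝ) ^ (1/6 : ℝ) := by
    rw [← Real.rpow_add hMp]; norm_num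
  have hR0 : 0 < R := by positivity
  by_cases hR1 : R < 1
  · have h1 := two_d_trivial I Iq B lo (8 * M) hq
    push_cast at h1
    have h2 : 1 ≤ (M : ℝ) ^ (1/6 : ℝ) := Real.one_le_rpow hM' (by norm_num)
    have h3 : c / 20 ≤ Eg N M := by
      calc c / 20 ≤ c / 20 * (M : ℝ) ^ (1/6 : ℝ) := le_mul_of_one_le_right (by positivity) h2
        _ = (M : ℝ) ^ (-(1/6) : ℝ) * R := by rw [hR, ← hMpow]; ring
        _ ≤ (M : ℝ) ^ (-(1/6) : ℝ) * 1 := by gcongr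
        _ ≤ _ := by rw [mul_one]; exact hE1
    calc _ ≤ 24 * (8 * (M : ℝ) + 1) := h1
      _ ≤ 216 * M := by linarith
      _ = C1 * M * (c / 20) := by rw [hC1]; field_simp
      _ ≤ C1 * M * Eg N M := by gcongr
      _ ≤ (C1 + C2) * M * Eg N M := by gcongr; exact le_add_of_nonneg_right (by positivity)
  · push Not at hR1
    have hL1 : 1 ≤ ⌊R⌋₊ := Nat.one_le_floor_iff _ |>.mpr hR1
    have hLR := Nat.floor_le hR0.le
    have hLR2 := Nat.lt_floor_add_one R
    set L := ⌊R⌋₊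
    have hL1' : (1 : ℝ) ≤ L := by exact_mod_cast hL1
    have hMc : ((M : ℝ) ^ (1/3 : ℝ)) ^ 3 = M := by
      rw [← Real.rpow_natCast, ← Real.rpow_mul hMp.le]; norm_num
    have hM13 : (M : ℝ) ^ (1/3 : ℝ) ≤ M := by
      conv_rhs => rw [← Real.rpow_one (M : ℝ)]
      exact Real.rpow_le_rpow_of_exponent_le hM' (by norm_num)
    have hLm : L ≤ 8 * M := by
      have : (L : ℝ) ≤ (8 * M : ℕ) := by
        push_cast
        calc (L : ℝ) ≤ R := hLR
          _ ≤ 1 * M := by rw [hR]; gcongr; linarith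
          _ ≤ _ := by linarith
      exact_mod_cast this
    have hLN : 1000 * (L : ℝ) ^ 3 < c ^ 3 * N := by
      calc 1000 * (L : ℝ) ^ 3 ≤ 1000 * R ^ 3 := by gcongr
        _ = c ^ 3 * (M / 8) := by rw [hR, mul_pow, hMc]; ring
        _ < c ^ 3 * N := by gcongr; linarith
    have := two_d_abs I Iq lo (8 * M) L B c N hc hc1 hN hL1 hLm hLN hI hIm hq hqb
    refine this.trans ?_
    have hL2 : R / 2 ≤ L := by linarith
    have hs1 : 1 / √(L : ℝ) ≤ (1 / √(c / 40)) * Eg N M := by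
      calc 1 / √(L : ℝ) ≤ 1 / √(c / 40 * (M : ℝ) ^ (1/3 : ℝ)) := by
            gcongr; rw [hR] at hL2; linarith
        _ = (1 / √(c / 40)) * (M : ℝ) ^ (-(1/6) : ℝ) := by
            rw [Real.sqrt_mul (by positivity), Real.sqrt_eq_rpow ((M : ℝ) ^ (1/3 : ℝ)), ← Real.rpow_mul hMp.le,
              Real.rpow_neg hMp.le]
            norm_num
            ring
        _ ≤ _ := by gcongr
    have hs2 : √(((8 * M : ℕ) : ℝ) / (c * N)) ≤ √(8 / c) * Eg N M := by
      rw [show ((8 * M : ℕ) : ℝ) / (c * N) = (8 / c) * (M / N) by push_cast; field_simp,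
        Real.sqrt_mul (by positivity)]
      gcongr
    calc 2 * (((8 * M : ℕ) : ℝ) * (56 / √L + 16 * √(((8 * M : ℕ) : ℝ) / (c * N))))
        = 2 * (8 * M * (56 * (1 / √L) + 16 * √(((8 * M : ℕ) : ℝ) / (c * N)))) := by
          push_cast; ring
      _ ≤ 2 * (8 * M * (56 * ((1 / √(c / 40)) * Eg N M) + 16 * (√(8 / c) * Eg N M))) := by gcongr
      _ = C2 * M * Eg N M := by rw [hC2]; ring
      _ ≤ (C1 + C2) * M * Eg N M := by gcongr; exact le_add_of_nonneg_left (by positivity)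



/-- the frequency space `ℝ × ℤⁿ` -/
abbrev XX (n : ℕ) := ℝ × (Fin n → ℤ)

/-- its measure -/
def muX (n : ℕ) : Measure (XX n) := (volume : Measure ℝ).prod Measure.count

/-- squared norm -/
def nsq {n : ℕ} (k : XX n) : ℝ := k.1 ^ 2 + ∑ i, ((k.2 i : ℤ) : ℝ) ^ 2

/-- frequency support set -/
def SS (n : ℕ) (N : ℝ) : Set (XX n) := {k | nsq k ≤ 4 * N ^ 2 ∧ (1 < N → N ^ 2 / 4 ≤ nsq k)}

lemma measurable_nsq {n : ℕ} : Measurable (nsq : XX n → ℝ) := by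
  unfold nsq
  have : ∀ i : Fin n, Measurable (fun k : XX n => ((k.2 i : ℤ) : ℝ)) := by
    intro i
    exact (measurable_of_countable (fun z : ℤ => (z : ℝ))).comp
      ((measurable_pi_apply i).comp measurable_snd)
  fun_prop

lemma measurableSet_SS (n : ℕ) (N : ℝ) : MeasurableSet (SS n N) := by
  unfold SS
  apply MeasurableSet.inter
  · exact measurableSet_le measurable_nsq measurable_const
  · by_cases h : 1 < N
    · simp only [h, true_imp_iff]; exact measurableSet_le measurable_const measurable_nsq
    · simp only [h, false_imp_iff]; exact MeasurableSet.univ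

lemma fiber_sum {n : ℕ} (p q : Fin n) (hpq : p ≠ q) (Ib : Fin n → Finset ℤ) (m : ℕ)
    (hcard : ∀ k, (Ib k).card ≤ m) (D T : ℝ) (hT0 : 0 ≤ T)
    (hT : ∀ B : ℝ, ∑ b ∈ Ib q, ∑ a ∈ Ib p, Hc (B - (b : ℝ) ^ 2 - (a : ℝ) ^ 2) ≤ T) :
    ∑ i ∈ Fintype.piFinset Ib, Hc (D - ∑ k, ((i k : ℤ) : ℝ) ^ 2) ≤ T * (m : ℝ) ^ (n - 2) := by
  set r : (Fin n → ℤ) → (Fin n → ℤ) := fun i => fun k => if k = p ∨ k = q then 0 else i k with hr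
  set Ib' : Fin n → Finset ℤ := fun k => if k = p ∨ k = q then {0} else Ib k with hIb'
  have hmaps : ∀ i ∈ Fintype.piFinset Ib, r i ∈ Fintype.piFinset Ib' := by
    intro i hi
    rw [Fintype.mem_piFinset] at hi ⊢
    intro k
    simp only [hr, hIb']
    split_ifs
    · simp
    · exact hi k
  rw [← Finset.sum_fiberwise_of_maps_to hmaps]
  have hsum : ∀ i : Fin n → ℤ, ∑ k, ((i k : ℤ) : ℝ) ^ 2 =
      ∑ k, ((r i k : ℤ) : ℝ) ^ 2 + (i q : ℝ) ^ 2 + (i p : ℝ) ^ 2 := by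
    intro i
    have : ∀ k, ((i k : ℤ) : ℝ) ^ 2 = ((r i k : ℤ) : ℝ) ^ 2 +
        ((if k = q then (i q : ℝ) ^ 2 else 0) + (if k = p then (i p : ℝ) ^ 2 else 0)) := by
      intro k
      by_cases h1 : k = p
      · subst h1; simp [hr, hpq]
      · by_cases h2 : k = q
        · subst h2; simp [hr, h1]
        · simp [hr, h1, h2]
    rw [Finset.sum_congr rfl (fun k _ => this k), Finset.sum_add_distrib, Finset.sum_add_distrib]
    simp; ring
  have hfib : ∀ i' ∈ Fintype.piFinset Ib',
      ∑ i ∈ (Fintype.piFinset Ib).filter (fun i => r i = i'), Hc (D - ∑ k, ((i k : ℤ) : ℝ) ^ 2) ≤ T := by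
    intro i' _
    refine le_trans ?_ (hT (D - ∑ k, ((i' k : ℤ) : ℝ) ^ 2))
    rw [← Finset.sum_product']
    set e : (Fin n → ℤ) → ℤ × ℤ := fun i => (i q, i p) with he
    set F : ℤ × ℤ → ℝ := fun x => Hc (D - ∑ k, ((i' k : ℤ) : ℝ) ^ 2 - (x.1 : ℝ) ^ 2 - (x.2 : ℝ) ^ 2) with hF
    have h1 : ∀ i ∈ (Fintype.piFinset Ib).filter (fun i => r i = i'),
        Hc (D - ∑ k, ((i k : ℤ) : ℝ) ^ 2) = F (e i) := by
      intro i hi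
      rw [Finset.mem_filter] at hi
      rw [hsum i, hi.2]
      simp only [hF, he]
      congr 1; ring
    rw [Finset.sum_congr rfl h1]
    rw [← Finset.sum_image (f := F) (g := e)]
    · apply Finset.sum_le_sum_of_subset_of_nonneg
      · intro x hx
        rw [Finset.mem_image] at hx
        obtain ⟨i, hi, rfl⟩ := hx
        rw [Finset.mem_filter, Fintype.mem_piFinset] at hi
        rw [Finset.mem_product]
        exact ⟨hi.1 q, hi.1 p⟩
      · intro x _ _; exact Hc_nonneg _
    · intro i hi j hj hij
      rw [Finset.mem_coe, Finset.mem_filter] at hi hj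
      simp only [he, Prod.mk.injEq] at hij
      funext k
      by_cases h1 : k = p
      · subst h1; exact hij.2
      · by_cases h2 : k = q
        · subst h2; exact hij.1
        · have := congrFun (hi.2.trans hj.2.symm) k
          simpa [hr, h1, h2] using this
  refine (Finset.sum_le_sum hfib).trans ?_
  rw [Finset.sum_const, nsmul_eq_mul, mul_comm]
  gcongr
  have : (Fintype.piFinset Ib').card ≤ m ^ (n - 2) := by
    rw [Fintype.card_piFinset]
    calc ∏ k, (Ib' k).card ≤ ∏ k, (if k = p ∨ k = q then 1 else m) := by
          apply Finset.prod_le_prod' 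
          intro k _
          simp only [hIb']
          split_ifs
          · simp
          · exact hcard k
      _ = m ^ (n - 2) := by
          rw [Finset.prod_ite]
          simp only [Finset.prod_const_one, one_mul, Finset.prod_const]
          congr 1
          have : (Finset.univ.filter (fun k : Fin n => ¬ (k = p ∨ k = q))) = (Finset.univ \ {p, q}) := by
            ext k; simp
          rw [this, Finset.card_sdiff_of_subset (Finset.subset_univ _), Finset.card_pair hpq]
          simp
  exact_mod_cast this

/-- doubled integer coordinates -/
def dbl {n : ℕ} (m j : Fin n → ℤ) : Fin n → ℤ := fun k => 2 * j k - m k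

lemma slice_sum {n : ℕ} (A : Set (XX n)) (hA : MeasurableSet A) (m : Fin n → ℤ)
    (Ib : Finset (Fin n → ℤ)) (f : (Fin n → ℤ) → ℝ) (hf : ∀ i, 0 ≤ f i)
    (hbox : ∀ k ∈ A, dbl m k.2 ∈ Ib)
    (hvol : ∀ j, volume {ζ : ℝ | (ζ, j) ∈ A} ≤ ENNReal.ofReal (f (dbl m j))) :
    muX n A ≤ ENNReal.ofReal (∑ i ∈ Ib, f i) := by
  unfold muX
  rw [Measure.prod_apply_symm hA, lintegral_count]
  have hinj : Function.Injective (dbl m) := by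
    intro a b hab
    funext k
    have := congrFun hab k
    simp only [dbl] at this
    omega
  calc ∑' j, volume ((fun ζ : ℝ => (ζ, j)) ⁻¹' A)
      ≤ ∑' j, (fun i => if i ∈ Ib then ENNReal.ofReal (f i) else 0) (dbl m j) := by
        apply ENNReal.tsum_le_tsum
        intro j
        by_cases h : dbl m j ∈ Ib
        · simp only [h, if_true]; exact hvol j
        · have : ((fun ζ : ℝ => (ζ, j)) ⁻¹' A) = ∅ := by
            ext ζ
            simp only [Set.mem_preimage, Set.mem_empty_iff_false, iff_false]
            intro hh; exact h (hbox _ hh)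
          rw [this]; simp
    _ ≤ ∑' i, (if i ∈ Ib then ENNReal.ofReal (f i) else 0) :=
        ENNReal.tsum_comp_le_tsum_of_injective hinj _
    _ = ∑ i ∈ Ib, ENNReal.ofReal (f i) := by
        rw [tsum_eq_sum (s := Ib)]
        · apply Finset.sum_congr rfl; intro i hi; simp [hi]
        · intro i hi; simp [hi]
    _ = _ := (ENNReal.ofReal_sum_of_nonneg (fun i _ => hf i)).symm

lemma vol_slice (ξ s : ℝ) :
    volume {ζ : ℝ | s ≤ (2 * ζ - ξ) ^ 2 ∧ (2 * ζ - ξ) ^ 2 ≤ s + 2} ≤ ENNReal.ofReal (Hc (s + 2)) := by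
  have h1 : {ζ : ℝ | s ≤ (2 * ζ - ξ) ^ 2 ∧ (2 * ζ - ξ) ^ 2 ≤ s + 2} =
      (fun x => 2 * x) ⁻¹' ((fun x => x + (-ξ)) ⁻¹' {w : ℝ | s ≤ w ^ 2 ∧ w ^ 2 ≤ s + 2}) := rfl
  rw [h1, Real.volume_preimage_mul_left (by norm_num), measure_preimage_add_right]
  refine le_trans ?_ (vol_le_Hc s)
  conv_rhs => rw [← one_mul (volume _)]
  gcongr
  rw [← ENNReal.ofReal_one]
  apply ENNReal.ofReal_le_ofReal
  norm_num

/-- the resonance set -/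
def Res (n : ℕ) (N₁ N₂ : ℝ) (P : XX n) (τ : ℝ) : Set (XX n) :=
  {k | k ∈ SS n N₁ ∧ P - k ∈ SS n N₂ ∧ τ ≤ nsq k + nsq (P - k) ∧ nsq k + nsq (P - k) ≤ τ + 1}

lemma measurable_sub_XX {n : ℕ} (P : XX n) : Measurable (fun k : XX n => P - k) := by
  have : Measurable (fun z : (Fin n → ℤ) => P.2 - z) := measurable_of_countable _
  exact Measurable.prodMk (measurable_const.sub measurable_fst) (this.comp measurable_snd)

lemma measurableSet_Res (n : ℕ) (N₁ N₂ : ℝ) (P : XX n) (τ : ℝ) : MeasurableSet (Res n N₁ N₂ P τ) := by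
  have h : Measurable (fun k : XX n => nsq k + nsq (P - k)) :=
    measurable_nsq.add (measurable_nsq.comp (measurable_sub_XX P))
  exact (measurableSet_SS n N₁).inter (((measurableSet_SS n N₂).preimage (measurable_sub_XX P)).inter
    ((measurableSet_le measurable_const h).inter (measurableSet_le h measurable_const)))

lemma nsq_id {n : ℕ} (P k : XX n) : 2 * (nsq k + nsq (P - k)) =
    (2 * k.1 - P.1) ^ 2 + ∑ i, ((dbl P.2 k.2 i : ℤ) : ℝ) ^ 2 + nsq P := by
  unfold nsq dbl
  simp only [Prod.fst_sub, Prod.snd_sub, Pi.sub_apply, Int.cast_sub, Int.cast_mul, Int.cast_ofNat]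
  have : ∑ i, (2 * (k.2 i : ℝ) - P.2 i) ^ 2 + ∑ i, (P.2 i : ℝ) ^ 2 =
      2 * (∑ i, (k.2 i : ℝ) ^ 2 + ∑ i, ((P.2 i : ℝ) - k.2 i) ^ 2) := by
    rw [← Finset.sum_add_distrib, ← Finset.sum_add_distrib, Finset.mul_sum]
    apply Finset.sum_congr rfl
    intro i _; ring
  linarith

lemma coord_le {n : ℕ} {k : XX n} {N : ℝ} (hN : 0 ≤ N) (h : k ∈ SS n N) :
    |k.1| ≤ 2 * N ∧ ∀ i, |((k.2 i : ℤ) : ℝ)| ≤ 2 * N := by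
  have h1 := h.1
  unfold nsq at h1
  have hs : ∀ i, ((k.2 i : ℤ) : ℝ) ^ 2 ≤ ∑ i, ((k.2 i : ℤ) : ℝ) ^ 2 := fun i =>
    Finset.single_le_sum (f := fun i => ((k.2 i : ℤ) : ℝ) ^ 2) (fun j _ => sq_nonneg _) (Finset.mem_univ i)
  constructor
  · have := Finset.sum_nonneg (s := Finset.univ) (f := fun i => ((k.2 i : ℤ) : ℝ) ^ 2) (fun i _ => sq_nonneg _)
    apply abs_le_of_sq_le_sq _ (by linarith)
    nlinarith
  · intro i
    apply abs_le_of_sq_le_sq _ (by linarith)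
    nlinarith [hs i, sq_nonneg k.1]

lemma coord_ge {n : ℕ} {k : XX n} {N : ℝ} (hN : 1 < N) (h : k ∈ SS n N) :
    N / (2 * (n + 1)) ≤ |k.1| ∨ ∃ i, N / (2 * (n + 1)) ≤ |((k.2 i : ℤ) : ℝ)| := by
  by_contra hcon
  push Not at hcon
  obtain ⟨h1, h2⟩ := hcon
  have h3 := h.2 hN
  unfold nsq at h3
  have hsq : ∀ x : ℝ, |x| < N / (2 * (n + 1)) → x ^ 2 < (N / (2 * (n + 1))) ^ 2 := by
    intro x hx
    exact sq_lt_sq.mpr (by rwa [abs_of_nonneg (a := N / (2 * ((n : ℝ) + 1))) (by positivity)])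
  have e1 := hsq _ h1
  have e2 : ∑ i, ((k.2 i : ℤ) : ℝ) ^ 2 ≤ ∑ i : Fin n, (N / (2 * ((n : ℝ) + 1))) ^ 2 :=
    Finset.sum_le_sum (fun i _ => (hsq _ (h2 i)).le)
  simp only [Finset.sum_const, Finset.card_univ, Fintype.card_fin, nsmul_eq_mul] at e2
  have e3 : (N / (2 * ((n : ℝ) + 1))) ^ 2 + n * (N / (2 * ((n : ℝ) + 1))) ^ 2 = N ^ 2 / 4 / (n + 1) := by
    field_simp; ring
  have e4 : N ^ 2 / 4 / ((n : ℝ) + 1) ≤ N ^ 2 / 4 := by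
    apply div_le_self (by positivity)
    have : (0 : ℝ) ≤ n := by positivity
    linarith
  linarith

lemma count_bound (n : ℕ) (hn : 2 ≤ n) : ∃ C : ℝ, 0 < C ∧ ∀ (M : ℕ) (N₁ : ℝ) (P : XX n) (τ : ℝ),
    1 ≤ M → (M : ℝ) ≤ N₁ →
    muX n (Res n N₁ M P τ) ≤ ENNReal.ofReal (C * (M : ℝ) ^ (n - 1) * Eg N₁ M) := by
  set c : ℝ := 1 / (4 * (n + 1)) with hc
  have hcp : 0 < c := by positivity
  have hc1 : c ≤ 1 := by
    rw [hc, div_le_one (by positivity)]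
    have : (0 : ℝ) ≤ n := by positivity
    linarith
  obtain ⟨C0, hC0, hgain⟩ := two_d_gain c hcp hc1
  set A : ℝ := 24 * (n + 1) with hA
  have hAp : 0 < A := by positivity
  set C1 : ℝ := 216 * 9 ^ (n - 2) * A with hC1
  set C2 : ℝ := C0 * 9 ^ (n - 2) with hC2
  set C3 : ℝ := 4 / c * 9 ^ n with hC3
  refine ⟨C1 + C2 + C3, by positivity, ?_⟩
  intro M N₁ P τ hM hMN
  have hM' : (1 : ℝ) ≤ M := by exact_mod_cast hM
  have hE := Eg_pos hM' hMN
  have hN1 : 0 < N₁ := by linarith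
  have hfin : ∀ X : ℝ, (X ≤ C1 * (M : ℝ) ^ (n - 1) * Eg N₁ M ∨ X ≤ C2 * (M : ℝ) ^ (n - 1) * Eg N₁ M ∨
      X ≤ C3 * (M : ℝ) ^ (n - 1) * Eg N₁ M) → X ≤ (C1 + C2 + C3) * (M : ℝ) ^ (n - 1) * Eg N₁ M := by
    intro X hX
    have p1 : 0 ≤ C1 * (M : ℝ) ^ (n - 1) * Eg N₁ M := by positivity
    have p2 : 0 ≤ C2 * (M : ℝ) ^ (n - 1) * Eg N₁ M := by positivity
    have p3 : 0 ≤ C3 * (M : ℝ) ^ (n - 1) * Eg N₁ M := by positivity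
    rw [add_mul, add_mul, add_mul, add_mul]
    rcases hX with h | h | h <;> linarith
  rcases (Res n N₁ M P τ).eq_empty_or_nonempty with he | ⟨k0, hk0⟩
  · rw [he]; simp
  set Ib : Fin n → Finset ℤ := fun k => Finset.Icc (P.2 k - 4 * M) (P.2 k + 4 * M) with hIb
  have hIbcard : ∀ k, (Ib k).card ≤ 8 * M + 1 := by
    intro k; simp only [hIb, Int.card_Icc]; omega
  have hbox : ∀ k ∈ Res n N₁ M P τ, dbl P.2 k.2 ∈ Fintype.piFinset Ib := by
    intro k hk
    rw [Fintype.mem_piFinset]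
    intro i
    have := (coord_le (by linarith) hk.2.1).2 i
    simp only [Prod.snd_sub, Pi.sub_apply] at this
    have h2 : |P.2 i - k.2 i| ≤ 2 * M := by exact_mod_cast this
    rw [abs_le] at h2
    simp only [hIb, Finset.mem_Icc, dbl]
    omega
  set D : ℝ := 2 * τ + 2 - nsq P with hD
  have hsl : ∀ j : Fin n → ℤ, ∀ ζ : ℝ, (ζ, j) ∈ Res n N₁ M P τ →
      D - ∑ k, ((dbl P.2 j k : ℤ) : ℝ) ^ 2 - 2 ≤ (2 * ζ - P.1) ^ 2 ∧
      (2 * ζ - P.1) ^ 2 ≤ (D - ∑ k, ((dbl P.2 j k : ℤ) : ℝ) ^ 2 - 2) + 2 := by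
    intro j ζ h
    have := nsq_id P (ζ, j)
    have h1 := h.2.2.1
    have h2 := h.2.2.2
    simp only at this
    constructor <;> linarith
  have hvolH : ∀ j, volume {ζ : ℝ | (ζ, j) ∈ Res n N₁ M P τ} ≤
      ENNReal.ofReal (Hc (D - ∑ k, ((dbl P.2 j k : ℤ) : ℝ) ^ 2)) := by
    intro j
    have := vol_slice P.1 (D - ∑ k, ((dbl P.2 j k : ℤ) : ℝ) ^ 2 - 2)
    rw [sub_add_cancel] at this
    refine le_trans (measure_mono ?_) this
    intro ζ hζ
    have := hsl j ζ hζ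
    rw [sub_add_cancel] at this
    exact this
  have hmeas := measurableSet_Res n N₁ M P τ
  have hsumH := slice_sum _ hmeas P.2 (Fintype.piFinset Ib)
    (fun i => Hc (D - ∑ k, ((i k : ℤ) : ℝ) ^ 2)) (fun i => Hc_nonneg _) hbox hvolH
  have h9 : (((8 * M + 1 : ℕ) : ℝ)) ≤ 9 * M := by push_cast; linarith
  have hpow : (M : ℝ) * (M : ℝ) ^ (n - 2) = (M : ℝ) ^ (n - 1) := by
    rw [← pow_succ']; congr 1; omega
  by_cases hcase : N₁ < A * M
  · -- no gain needed
    refine hsumH.trans (ENNReal.ofReal_le_ofReal (hfin _ (Or.inl ?_)))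
    have := fiber_sum (⟨0, by omega⟩ : Fin n) ⟨1, by omega⟩ (by simp) Ib (8 * M + 1) hIbcard D
      (24 * ((8 * M : ℕ) + 1)) (by positivity) (fun B => two_d_trivial _ _ B (P.2 ⟨1, by omega⟩ - 4 * M) (8 * M) (by
        intro b hb
        simp only [hIb, Finset.mem_Icc] at hb
        push_cast
        omega))
    refine this.trans ?_
    have hE3 : 1 / A ≤ Eg N₁ M := by
      refine le_trans ?_ (Eg_ge3 hM' hMN)
      rw [div_le_div_iff₀ hAp hN1]; linarith
    calc 24 * (((8 * M : ℕ) : ℝ) + 1) * ((8 * M + 1 : ℕ) : ℝ) ^ (n - 2)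
        ≤ 24 * (9 * M) * (9 * M) ^ (n - 2) := by
          gcongr; push_cast; linarith
      _ = 216 * 9 ^ (n - 2) * A * ((M : ℝ) * (M : ℝ) ^ (n - 2)) * (1 / A) := by
          rw [mul_pow]; field_simp; ring
      _ ≤ C1 * (M : ℝ) ^ (n - 1) * Eg N₁ M := by rw [hpow]; gcongr
  push Not at hcase
  have hn0 : (0 : ℝ) ≤ n := by positivity
  have hN1' : 1 < N₁ := by
    have : (24 : ℝ) ≤ A := by rw [hA]; linarith
    nlinarith
  have hlow : c * N₁ + 6 * M ≤ N₁ / (2 * (n + 1)) := by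
    have : N₁ / (2 * ((n : ℝ) + 1)) = c * N₁ + c * N₁ := by rw [hc]; field_simp; ring
    rw [this]
    have : 6 * (M : ℝ) = c * (A * M) := by rw [hc, hA]; field_simp; norm_num
    rw [this]
    gcongr
  rcases coord_ge hN1' hk0.1 with hz | ⟨p, hp⟩
  · -- large continuous frequency
    have hP : c * N₁ + 4 * M ≤ |P.1| := by
      have h1 := (coord_le (by linarith) hk0.2.1).1
      simp only [Prod.fst_sub] at h1
      have := abs_sub_abs_le_abs_sub k0.1 P.1
      rw [abs_sub_comm] at this
      linarith
    have hcN : 0 < c * N₁ := by positivity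
    have := slice_sum _ hmeas P.2 (Fintype.piFinset Ib)
      (fun i => 4 / (c * N₁)) (fun i => by positivity) hbox (by
        intro j
        rcases {ζ : ℝ | (ζ, j) ∈ Res n N₁ M P τ}.eq_empty_or_nonempty with he | ⟨ζ, hζ⟩
        · rw [he]; simp
        refine (hvolH j).trans (ENNReal.ofReal_le_ofReal ?_)
        have hζ' : (ζ, j) ∈ Res n N₁ M P τ := hζ
        have h1 := (hsl j ζ hζ').2
        have h2 := (coord_le (by linarith) hζ'.2.1).1
        simp only [Prod.fst_sub] at h2
        have h3 : c * N₁ ≤ |2 * ζ - P.1| := by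
          have := abs_sub_abs_le_abs_sub P.1 (P.1 - (2 * ζ - P.1))
          rw [sub_sub_cancel] at this
          have e : |P.1 - (2 * ζ - P.1)| = 2 * |P.1 - ζ| := by
            rw [← abs_two (α := ℝ), ← abs_mul, abs_two]; congr 1; ring
          rw [e] at this
          linarith
        have h4 : (c * N₁) ^ 2 ≤ (2 * ζ - P.1) ^ 2 := by
          rw [← sq_abs (2 * ζ - P.1)]; gcongr
        have := Hc_le_of_le (σ := D - ∑ k, ((dbl P.2 j k : ℤ) : ℝ) ^ 2) (c := (c * N₁) ^ 2)
          (by positivity) (by linarith)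
        rwa [Real.sqrt_sq hcN.le] at this)
    refine this.trans (ENNReal.ofReal_le_ofReal (hfin _ (Or.inr (Or.inr ?_))))
    rw [Finset.sum_const, nsmul_eq_mul, Fintype.card_piFinset]
    have hcd : ((∏ k, (Ib k).card : ℕ) : ℝ) ≤ (9 * M) ^ n := by
      push_cast
      calc ∏ k, ((Ib k).card : ℝ) ≤ ∏ k : Fin n, (9 * M : ℝ) := by
            apply Finset.prod_le_prod (fun _ _ => by positivity)
            intro k _
            refine le_trans ?_ h9
            exact_mod_cast hIbcard k
        _ = _ := by simp
    calc _ ≤ (9 * (M : ℝ)) ^ n * (4 / (c * N₁)) := by gcongr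
      _ = C3 * (M : ℝ) ^ (n - 1) * (M / N₁) := by
          have : (M : ℝ) ^ n = (M : ℝ) ^ (n - 1) * M := by rw [← pow_succ]; congr 1; omega
          rw [hC3, mul_pow, this]; field_simp
      _ ≤ _ := by gcongr; exact Eg_ge3 hM' hMN
  · -- large discrete frequency
    obtain ⟨q, hq⟩ : ∃ q : Fin n, p ≠ q := by
      have : Nontrivial (Fin n) := Fin.nontrivial_iff_two_le.mpr hn
      obtain ⟨q, hq⟩ := exists_ne p
      exact ⟨q, hq.symm⟩
    refine hsumH.trans (ENNReal.ofReal_le_ofReal (hfin _ (Or.inr (Or.inl ?_))))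
    have hk2 := (coord_le (by linarith) hk0.2.1).2
    have hk1 := (coord_le hN1.le hk0.1).2
    simp only [Prod.snd_sub, Pi.sub_apply, Int.cast_sub] at hk2
    have hIbr : ∀ k, ∀ a ∈ Ib k, |(a : ℝ) - P.2 k| ≤ 4 * M := by
      intro k a ha
      simp only [hIb, Finset.mem_Icc] at ha
      have : |a - P.2 k| ≤ 4 * M := by rw [abs_le]; omega
      exact_mod_cast this
    have := fiber_sum p q hq Ib (8 * M + 1) hIbcard D (C0 * M * Eg N₁ M) (by positivity) (fun B =>
      hgain (Ib p) (Ib q) (P.2 q - 4 * M) M B N₁ hM hMN (by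
        intro a ha
        have h1 := hIbr p a ha
        have h2 := hk2 p
        rw [abs_le] at h1 h2
        rcases le_abs.mp hp with h | h
        · exact le_trans (by linarith) (le_abs_self _)
        · exact le_trans (by linarith) (neg_le_abs _)) (by
        intro a ha a' ha'
        simp only [hIb, Finset.mem_Icc] at ha ha'
        push_cast; omega) (by
        intro b hb
        simp only [hIb, Finset.mem_Icc] at hb
        push_cast; omega) (by
        intro b hb
        have h1 := hIbr q b hb
        have h2 := hk2 q
        have h3 := hk1 q
        rw [abs_le] at h1 h2 h3 ⊢
        constructor <;> linarith))
    refine this.trans ?_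
    calc C0 * M * Eg N₁ M * ((8 * M + 1 : ℕ) : ℝ) ^ (n - 2)
        ≤ C0 * M * Eg N₁ M * (9 * M) ^ (n - 2) := by gcongr
      _ = C2 * ((M : ℝ) * (M : ℝ) ^ (n - 2)) * Eg N₁ M := by rw [hC2, mul_pow]; ring
      _ = _ := by rw [hpow]



lemma schur_pt (x y w : ℝ≥0∞) : 2 * (x * y * w) ≤ x ^ 2 * w + y ^ 2 * w := by
  have h : 2 * (x * y) ≤ x ^ 2 + y ^ 2 := by
    rcases eq_or_ne x ∞ with rfl | hx
    · simp
    rcases eq_or_ne y ∞ with rfl | hy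
    · simp
    lift x to ℝ≥0 using hx
    lift y to ℝ≥0 using hy
    have := two_mul_le_add_sq x y
    exact_mod_cast (by simpa [mul_assoc] using this : 2 * (x * y) ≤ x ^ 2 + y ^ 2)
  calc 2 * (x * y * w) = 2 * (x * y) * w := by ring
    _ ≤ (x ^ 2 + y ^ 2) * w := by gcongr
    _ = _ := by ring

/-- Schur test in TT* form. -/
lemma schur_TT {Y Z : Type*} [MeasurableSpace Y] [MeasurableSpace Z] (ν : Measure Y) [SigmaFinite ν]
    (ρ : Measure Z) [IsFiniteMeasure ρ] (E : Y → Z → ℂ) (hE : Measurable (Function.uncurry E))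
    (hE1 : ∀ a z, ‖E a z‖ ≤ 1) (G : Y → ℂ) (hGm : Measurable G) (hG : Integrable G ν)
    (S : Set Y) (hS : MeasurableSet S) (hGS : ∀ a, G a ≠ 0 → a ∈ S)
    (k : Y → Y → ℝ≥0∞) (hk : Measurable (Function.uncurry k)) (hsym : ∀ a b, k a b = k b a)
    (hK : ∀ a b, ‖∫ z, E a z * (starRingEnd ℂ) (E b z) ∂ρ‖ₑ ≤ k a b) (M : ℝ≥0∞)
    (hM : ∀ b, ∫⁻ a in S, k a b ∂ν ≤ M) :
    ∫⁻ z, ‖∫ a, G a * E a z ∂ν‖ₑ ^ 2 ∂ρ ≤ M * ∫⁻ a, ‖G a‖ₑ ^ 2 ∂ν := by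
  set U : Z → ℂ := fun z => ∫ a, G a * E a z ∂ν with hU
  have hF : Measurable (fun p : Z × Y => G p.2 * E p.2 p.1) :=
    (hGm.comp measurable_snd).mul (hE.comp measurable_swap)
  have hUm : StronglyMeasurable U :=
    StronglyMeasurable.integral_prod_right (f := fun z a => G a * E a z) hF.stronglyMeasurable
  have hUb : ∀ z, ‖U z‖ ≤ ∫ a, ‖G a‖ ∂ν := by
    intro z
    refine norm_integral_le_of_norm_le hG.norm (Filter.Eventually.of_forall fun a => ?_)
    rw [norm_mul]
    exact mul_le_of_le_one_right (norm_nonneg _) (hE1 a z)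
  have hU2 : Integrable (fun z => ‖U z‖ ^ 2) ρ := by
    refine Integrable.of_bound (hUm.norm.pow 2).aestronglyMeasurable ((∫ a, ‖G a‖ ∂ν) ^ 2)
      (Filter.Eventually.of_forall fun z => ?_)
    rw [Real.norm_of_nonneg (by positivity)]
    exact pow_le_pow_left₀ (norm_nonneg _) (hUb z) 2
  have e1 : ∫⁻ z, ‖U z‖ₑ ^ 2 ∂ρ = ENNReal.ofReal (∫ z, ‖U z‖ ^ 2 ∂ρ) := by
    rw [ofReal_integral_eq_lintegral_ofReal hU2 (Filter.Eventually.of_forall fun z => by positivity)]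
    refine lintegral_congr fun z => ?_
    rw [ENNReal.ofReal_pow (norm_nonneg _), ofReal_norm]
  have e2 : ((∫ z, ‖U z‖ ^ 2 ∂ρ : ℝ) : ℂ) = ∫ z, ∫ p : Y × Y, (G p.1 * E p.1 z) * (starRingEnd ℂ) (G p.2 * E p.2 z)
      ∂(ν.prod ν) ∂ρ := by
    rw [← integral_complex_ofReal]
    refine integral_congr_ae (Filter.Eventually.of_forall fun z => ?_)
    simp only
    rw [integral_prod_mul (fun a => G a * E a z) (fun b => (starRingEnd ℂ) (G b * E b z)), integral_conj]
    rw [Complex.ofReal_pow, ← Complex.mul_conj']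
  have hIntg : Integrable (Function.uncurry fun (z : Z) (p : Y × Y) =>
      (G p.1 * E p.1 z) * (starRingEnd ℂ) (G p.2 * E p.2 z)) (ρ.prod (ν.prod ν)) := by
    have hdom : Integrable (fun q : Z × (Y × Y) => (1 : ℝ) * (‖G q.2.1‖ * ‖G q.2.2‖)) (ρ.prod (ν.prod ν)) :=
      Integrable.mul_prod (f := fun _ : Z => (1 : ℝ)) (g := fun p : Y × Y => ‖G p.1‖ * ‖G p.2‖) (integrable_const 1)
        (Integrable.mul_prod hG.norm hG.norm)
    refine hdom.mono' ?_ (Filter.Eventually.of_forall ?_)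
    · apply Measurable.aestronglyMeasurable
      have m1 : Measurable (fun q : Z × (Y × Y) => G q.2.1 * E q.2.1 q.1) :=
        (hGm.comp (by fun_prop)).mul (hE.comp (by fun_prop : Measurable fun q : Z × (Y × Y) => (q.2.1, q.1)))
      have m2 : Measurable (fun q : Z × (Y × Y) => G q.2.2 * E q.2.2 q.1) :=
        (hGm.comp (by fun_prop)).mul (hE.comp (by fun_prop : Measurable fun q : Z × (Y × Y) => (q.2.2, q.1)))
      exact m1.mul (Complex.continuous_conj.measurable.comp m2)
    · rintro ⟨z, a, b⟩
      simp only [Function.uncurry, norm_mul, RCLike.norm_conj, one_mul]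
      have h1 : ‖G a‖ * ‖E a z‖ ≤ ‖G a‖ := mul_le_of_le_one_right (norm_nonneg _) (hE1 a z)
      have h2 : ‖G b‖ * ‖E b z‖ ≤ ‖G b‖ := mul_le_of_le_one_right (norm_nonneg _) (hE1 b z)
      gcongr
  rw [integral_integral_swap hIntg] at e2
  have e3 : ∫⁻ z, ‖U z‖ₑ ^ 2 ∂ρ ≤ ∫⁻ p : Y × Y, ‖G p.1‖ₑ * ‖G p.2‖ₑ * k p.1 p.2 ∂(ν.prod ν) := by
    rw [e1]
    have h0 : (0 : ℝ) ≤ ∫ z, ‖U z‖ ^ 2 ∂ρ := integral_nonneg fun z => by positivity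
    have : ENNReal.ofReal (∫ z, ‖U z‖ ^ 2 ∂ρ) = ‖((∫ z, ‖U z‖ ^ 2 ∂ρ : ℝ) : ℂ)‖ₑ := by
      rw [← ofReal_norm, Complex.norm_real, Real.norm_of_nonneg h0]
    rw [this, e2]
    refine (enorm_integral_le_lintegral_enorm _).trans (lintegral_mono fun p => ?_)
    have : (∫ z, (G p.1 * E p.1 z) * (starRingEnd ℂ) (G p.2 * E p.2 z) ∂ρ) =
        (G p.1 * (starRingEnd ℂ) (G p.2)) * ∫ z, E p.1 z * (starRingEnd ℂ) (E p.2 z) ∂ρ := by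
      rw [← integral_const_mul]
      refine integral_congr_ae (Filter.Eventually.of_forall fun z => ?_)
      simp only [map_mul]; ring
    rw [this, enorm_mul, enorm_mul]
    have h3 : ‖(starRingEnd ℂ) (G p.2)‖ₑ = ‖G p.2‖ₑ := by
      rw [← ofReal_norm, ← ofReal_norm, RCLike.norm_conj]
    rw [h3]
    gcongr
    exact hK _ _
  refine e3.trans ?_
  set k' : Y → Y → ℝ≥0∞ := fun a b => S.indicator 1 a * (S.indicator 1 b * k a b) with hk'
  have hind : Measurable (S.indicator (1 : Y → ℝ≥0∞)) := measurable_one.indicator hS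
  have hk'm : Measurable (Function.uncurry k') :=
    (hind.comp measurable_fst).mul ((hind.comp measurable_snd).mul hk)
  have hG2 : Measurable (fun a => ‖G a‖ₑ ^ 2) := hGm.enorm.pow_const 2
  have hk'M : ∀ b, ∫⁻ a, k' a b ∂ν ≤ M := by
    intro b
    refine le_trans ?_ (hM b)
    rw [← lintegral_indicator hS]
    refine lintegral_mono fun a => ?_
    simp only [hk', Set.indicator]
    split_ifs <;> simp
  have hk's : ∀ a b, k' a b = k' b a := by
    intro a b; simp only [hk', hsym a b]; ring
  have half : ∫⁻ p : Y × Y, ‖G p.2‖ₑ ^ 2 * k' p.1 p.2 ∂(ν.prod ν) ≤ M * ∫⁻ a, ‖G a‖ₑ ^ 2 ∂ν := by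
    have hmm : Measurable (fun p : Y × Y => ‖G p.2‖ₑ ^ 2 * k' p.1 p.2) :=
      (hG2.comp measurable_snd).mul hk'm
    rw [lintegral_prod_symm' _ hmm, ← lintegral_const_mul _ hG2]
    refine lintegral_mono fun b => ?_
    simp only
    rw [lintegral_const_mul (f := fun a => k' a b) _ (hk'm.comp (by fun_prop : Measurable fun a : Y => (a, b))), mul_comm]
    exact mul_le_mul_left (hk'M b) _
  have half' : ∫⁻ p : Y × Y, ‖G p.1‖ₑ ^ 2 * k' p.1 p.2 ∂(ν.prod ν) ≤ M * ∫⁻ a, ‖G a‖ₑ ^ 2 ∂ν := by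
    refine le_trans (le_of_eq ?_) half
    rw [← lintegral_prod_swap]
    refine lintegral_congr fun p => ?_
    simp only [Prod.fst_swap, Prod.snd_swap]
    rw [hk's]
  have two : 2 * ∫⁻ p : Y × Y, ‖G p.1‖ₑ * ‖G p.2‖ₑ * k p.1 p.2 ∂(ν.prod ν) ≤
      2 * (M * ∫⁻ a, ‖G a‖ₑ ^ 2 ∂ν) := by
    have hm0 : Measurable (fun p : Y × Y => ‖G p.1‖ₑ ^ 2 * k' p.1 p.2) :=
      (hG2.comp measurable_fst).mul hk'm
    have hm1 : Measurable (fun p : Y × Y => ‖G p.1‖ₑ * ‖G p.2‖ₑ * k p.1 p.2) :=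
      ((hGm.enorm.comp measurable_fst).mul (hGm.enorm.comp measurable_snd)).mul hk
    rw [← lintegral_const_mul _ hm1]
    calc _ ≤ ∫⁻ p : Y × Y, ‖G p.1‖ₑ ^ 2 * k' p.1 p.2 + ‖G p.2‖ₑ ^ 2 * k' p.1 p.2 ∂(ν.prod ν) := by
          refine lintegral_mono fun p => ?_
          refine le_trans (le_of_eq ?_) (schur_pt ‖G p.1‖ₑ ‖G p.2‖ₑ (k' p.1 p.2))
          by_cases h1 : G p.1 = 0
          · simp [h1]
          by_cases h2 : G p.2 = 0
          · simp [h2]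
          simp [hk', hGS _ h1, hGS _ h2]
      _ ≤ _ := by
          rw [lintegral_add_left hm0, two_mul]
          exact add_le_add half' half
  exact (ENNReal.mul_le_mul_iff_right (by norm_num) (by norm_num)).1 two


lemma oned_torus (m : ℤ) : ‖∫ y in Set.Icc (0 : ℝ) (2 * Real.pi), Complex.exp (((y * (m : ℝ) : ℝ) : ℂ) * Complex.I)‖ₑ
    ≤ if m = 0 then ENNReal.ofReal (2 * Real.pi) else 0 := by
  split_ifs with h
  · subst h
    refine (enorm_integral_le_lintegral_enorm _).trans ?_
    simp
  · rw [integral_Icc_eq_integral_Ioc, ← intervalIntegral.integral_of_le (by positivity)]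
    have hc : (m : ℂ) * Complex.I ≠ 0 := mul_ne_zero (by exact_mod_cast h) Complex.I_ne_zero
    have := integral_exp_mul_complex (a := 0) (b := 2 * Real.pi) hc
    have e : (∫ y in (0:ℝ)..(2 * Real.pi), Complex.exp (((y * (m : ℝ) : ℝ) : ℂ) * Complex.I)) =
        ∫ y in (0:ℝ)..(2 * Real.pi), Complex.exp ((m : ℂ) * Complex.I * y) := by
      refine intervalIntegral.integral_congr fun y _ => ?_
      congr 1; push_cast; ring
    rw [e, this]
    have : Complex.exp ((m : ℂ) * Complex.I * ((2 * Real.pi : ℝ) : ℂ)) = 1 := by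
      rw [Complex.exp_eq_one_iff]; exact ⟨m, by push_cast; ring⟩
    rw [this]; simp

lemma nd_torus (n : ℕ) (m : Fin n → ℤ) :
    ‖∫ y in torusBox 1 n, Complex.exp (((∑ i, y i * (m i : ℝ) : ℝ) : ℂ) * Complex.I)‖ₑ
    ≤ if m = 0 then ENNReal.ofReal (2 * Real.pi) ^ n else 0 := by
  have hbox : torusBox 1 n = Set.pi Set.univ (fun _ : Fin n => Set.Icc (0 : ℝ) (2 * Real.pi)) := by
    ext y; simp [torusBox, Pi.le_def]
  have e : (∫ y in torusBox 1 n, Complex.exp (((∑ i, y i * (m i : ℝ) : ℝ) : ℂ) * Complex.I)) =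
      ∏ i, ∫ y in Set.Icc (0 : ℝ) (2 * Real.pi), Complex.exp (((y * (m i : ℝ) : ℝ) : ℂ) * Complex.I) := by
    rw [hbox, volume_pi, Measure.restrict_pi_pi]
    rw [← integral_fintype_prod_eq_prod]
    refine integral_congr_ae (Filter.Eventually.of_forall fun y => ?_)
    simp only
    rw [← Complex.exp_sum]; congr 1; push_cast; rw [Finset.sum_mul]
  have hprod : ∀ (s : Finset (Fin n)) (f : Fin n → ℂ), ‖∏ i ∈ s, f i‖ₑ = ∏ i ∈ s, ‖f i‖ₑ := by
    intro s f
    induction s using Finset.induction_on with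
    | empty => simp
    | insert a s ha ih => rw [Finset.prod_insert ha, Finset.prod_insert ha, enorm_mul, ih]
  rw [e, hprod]
  split_ifs with h
  · calc _ ≤ ∏ i : Fin n, ENNReal.ofReal (2 * Real.pi) := by
          refine Finset.prod_le_prod' fun i _ => (oned_torus (m i)).trans ?_
          simp [h]
      _ = _ := by simp
  · obtain ⟨i, hi⟩ := Function.ne_iff.1 h
    have := oned_torus (m i)
    simp only [Pi.zero_apply] at hi
    rw [if_neg hi] at this
    rw [Finset.prod_eq_zero (Finset.mem_univ i) (le_antisymm this bot_le)]

lemma gauss_char (v : ℝ≥0) (s : ℝ) :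
    ‖∫ x, Complex.exp (((x * s : ℝ) : ℂ) * Complex.I) ∂(ProbabilityTheory.gaussianReal 0 v)‖ₑ =
      ENNReal.ofReal (Real.exp (-(v * s ^ 2 / 2))) := by
  have h := ProbabilityTheory.charFun_gaussianReal (μ := 0) (v := v) s
  rw [charFun_apply_real] at h
  have e : (∫ x, Complex.exp (((x * s : ℝ) : ℂ) * Complex.I) ∂(ProbabilityTheory.gaussianReal 0 v)) =
      Complex.exp (((-(v * s ^ 2 / 2) : ℝ)) : ℂ) := by
    rw [show Complex.exp (((-(v * s ^ 2 / 2) : ℝ)) : ℂ) = Complex.exp (s * ((0 : ℝ) : ℂ) * Complex.I - ((v : ℝ) : ℂ) * s ^ 2 / 2) by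
      congr 1; push_cast; ring, ← h]
    refine integral_congr_ae (Filter.Eventually.of_forall fun y => ?_)
    simp only; congr 1; push_cast; ring
  rw [e, ← Complex.ofReal_exp, ← ofReal_norm, Complex.norm_real, Real.norm_of_nonneg (Real.exp_pos _).le]

/-- The phase function of the product wave. -/
def EE {n : ℕ} (a : XX n × XX n) (z : ℝ × ℝ × (Fin n → ℝ)) : ℂ :=
  Complex.exp (((z.2.1 * (a.1.1 + a.2.1) + ∑ i, z.2.2 i * ((a.1.2 i + a.2.2 i : ℤ) : ℝ)
    - z.1 * (nsq a.1 + nsq a.2) : ℝ) : ℂ) * Complex.I)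

def rhoZ (n : ℕ) (v : ℝ≥0) : Measure (ℝ × ℝ × (Fin n → ℝ)) :=
  (ProbabilityTheory.gaussianReal 0 1).prod ((ProbabilityTheory.gaussianReal 0 v).prod (volume.restrict (torusBox 1 n)))

def kerK (n : ℕ) (v : ℝ≥0) (a b : XX n × XX n) : ℝ≥0∞ :=
  ENNReal.ofReal (Real.exp (-((nsq a.1 + nsq a.2) - (nsq b.1 + nsq b.2)) ^ 2 / 2)) *
  (ENNReal.ofReal (Real.exp (-(v * ((a.1.1 + a.2.1) - (b.1.1 + b.2.1)) ^ 2 / 2))) *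
    if a.1.2 + a.2.2 = b.1.2 + b.2.2 then ENNReal.ofReal (2 * Real.pi) ^ n else 0)

instance rhoZ_finite (n : ℕ) (v : ℝ≥0) : IsFiniteMeasure (rhoZ n v) := by
  have : IsFiniteMeasure ((volume : Measure (Fin n → ℝ)).restrict (torusBox 1 n)) := by
    constructor
    rw [Measure.restrict_apply_univ, torusBox]
    exact isCompact_Icc.measure_lt_top
  unfold rhoZ
  infer_instance

lemma measurable_EE (n : ℕ) : Measurable (Function.uncurry (EE (n := n))) := by
  have h1 : Measurable (fun p : (XX n × XX n) × (ℝ × ℝ × (Fin n → ℝ)) => nsq p.1.1) :=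
    measurable_nsq.comp (by fun_prop)
  have h2 : Measurable (fun p : (XX n × XX n) × (ℝ × ℝ × (Fin n → ℝ)) => nsq p.1.2) :=
    measurable_nsq.comp (by fun_prop)
  have hz : Measurable (fun k : ℤ => (k : ℝ)) := measurable_of_countable _
  have h3 : ∀ i, Measurable (fun p : (XX n × XX n) × (ℝ × ℝ × (Fin n → ℝ)) => ((p.1.1.2 i + p.1.2.2 i : ℤ) : ℝ)) := by
    intro i
    exact hz.comp (by fun_prop)
  unfold Function.uncurry EE
  refine Complex.measurable_exp.comp (Measurable.mul_const (Complex.measurable_ofReal.comp ?_) _)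
  refine Measurable.sub (Measurable.add (by fun_prop) ?_) (Measurable.mul (by fun_prop) (h1.add h2))
  refine Finset.measurable_sum _ fun i _ => ?_
  exact Measurable.mul (by fun_prop) (h3 i)

lemma measurable_kerK (n : ℕ) (v : ℝ≥0) : Measurable (Function.uncurry (kerK n v)) := by
  have h1 : Measurable (fun p : (XX n × XX n) × (XX n × XX n) => nsq p.1.1) := measurable_nsq.comp (by fun_prop)
  have h2 : Measurable (fun p : (XX n × XX n) × (XX n × XX n) => nsq p.1.2) := measurable_nsq.comp (by fun_prop)
  have h3 : Measurable (fun p : (XX n × XX n) × (XX n × XX n) => nsq p.2.1) := measurable_nsq.comp (by fun_prop)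
  have h4 : Measurable (fun p : (XX n × XX n) × (XX n × XX n) => nsq p.2.2) := measurable_nsq.comp (by fun_prop)
  unfold Function.uncurry kerK
  refine Measurable.mul (by fun_prop) (Measurable.mul (by fun_prop) (Measurable.ite ?_ measurable_const measurable_const))
  exact measurableSet_eq_fun (by fun_prop) (by fun_prop)

lemma kerK_symm (n : ℕ) (v : ℝ≥0) (a b : XX n × XX n) : kerK n v a b = kerK n v b a := by
  unfold kerK
  congr 1
  · congr 3; ring
  congr 1
  · congr 3; ring
  · simp only [eq_comm]

lemma EE_norm {n : ℕ} (a : XX n × XX n) (z : ℝ × ℝ × (Fin n → ℝ)) : ‖EE a z‖ ≤ 1 := by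
  unfold EE; rw [Complex.norm_exp_ofReal_mul_I]

lemma kerK_bound (n : ℕ) (v : ℝ≥0) (a b : XX n × XX n) :
    ‖∫ z, EE a z * (starRingEnd ℂ) (EE b z) ∂(rhoZ n v)‖ₑ ≤ kerK n v a b := by
  have e : (∫ z, EE a z * (starRingEnd ℂ) (EE b z) ∂(rhoZ n v)) =
      (∫ t, Complex.exp (((t * (-((nsq a.1 + nsq a.2) - (nsq b.1 + nsq b.2))) : ℝ) : ℂ) * Complex.I)
        ∂(ProbabilityTheory.gaussianReal 0 1)) *
      ((∫ x, Complex.exp (((x * ((a.1.1 + a.2.1) - (b.1.1 + b.2.1)) : ℝ) : ℂ) * Complex.I)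
        ∂(ProbabilityTheory.gaussianReal 0 v)) *
      ∫ y in torusBox 1 n, Complex.exp (((∑ i, y i * (((a.1.2 + a.2.2 - (b.1.2 + b.2.2)) i : ℤ) : ℝ) : ℝ) : ℂ) * Complex.I)) := by
    rw [← integral_prod_mul, ← integral_prod_mul]
    unfold rhoZ
    refine integral_congr_ae (Filter.Eventually.of_forall fun z => ?_)
    simp only [EE]
    rw [← Complex.exp_conj, ← Complex.exp_add, ← Complex.exp_add, ← Complex.exp_add]
    congr 1
    rw [map_mul, Complex.conj_ofReal, Complex.conj_I]
    have hs : ∑ i, z.2.2 i * (((a.1.2 + a.2.2 - (b.1.2 + b.2.2)) i : ℤ) : ℝ) =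
        ∑ i, z.2.2 i * ((a.1.2 i + a.2.2 i : ℤ) : ℝ) - ∑ i, z.2.2 i * ((b.1.2 i + b.2.2 i : ℤ) : ℝ) := by
      rw [← Finset.sum_sub_distrib]
      refine Finset.sum_congr rfl fun i _ => ?_
      simp only [Pi.add_apply, Pi.sub_apply]; push_cast; ring
    rw [hs]
    generalize ∑ i, z.2.2 i * ((a.1.2 i + a.2.2 i : ℤ) : ℝ) = A
    generalize ∑ i, z.2.2 i * ((b.1.2 i + b.2.2 i : ℤ) : ℝ) = B
    push_cast; ring
  rw [e, enorm_mul, enorm_mul, gauss_char, gauss_char]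
  unfold kerK
  gcongr ?_ * (?_ * ?_)
  · apply le_of_eq; congr 2
    simp only [NNReal.coe_one]; ring
  · exact le_rfl
  · refine (nd_torus n _).trans (le_of_eq ?_)
    simp only [sub_eq_zero]


lemma exp_sum_bound : ∃ c : ℤ → ℝ≥0∞, (∑' l, c l) ≠ ∞ ∧ ∀ s : ℝ, ∀ l : ℤ, (l : ℝ) ≤ s → s ≤ l + 1 →
    ENNReal.ofReal (Real.exp (-s ^ 2 / 2)) ≤ c l := by
  have hs := (Real.summable_one_div_int_add_rpow (1 / 2) 2).2 (by norm_num)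
  refine ⟨fun l => ENNReal.ofReal (4 * (1 / |(l : ℝ) + 1 / 2| ^ (2 : ℝ))), ?_, ?_⟩
  · exact (hs.mul_left 4).tsum_ofReal_ne_top
  · intro s l h1 h2
    apply ENNReal.ofReal_le_ofReal
    have hne : (l : ℝ) + 1 / 2 ≠ 0 := by
      intro h
      have : (2 * l + 1 : ℝ) = 0 := by linarith
      have : (2 * l + 1 : ℤ) = 0 := by exact_mod_cast this
      omega
    have hpos : 0 < ((l : ℝ) + 1 / 2) ^ 2 := by positivity
    have e : |(l : ℝ) + 1 / 2| ^ (2 : ℝ) = ((l : ℝ) + 1 / 2) ^ 2 := by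
      rw [show (2 : ℝ) = ((2 : ℕ) : ℝ) by norm_num, Real.rpow_natCast, sq_abs]
    rw [e, neg_div, Real.exp_neg]
    have h3 := Real.add_one_le_exp (s ^ 2 / 2)
    have h4 : ((l : ℝ) + 1 / 2) ^ 2 ≤ 4 * Real.exp (s ^ 2 / 2) := by
      nlinarith [sq_nonneg (s + (s - l - 1/2)), sq_nonneg (s - l - 1 / 2)]
    rw [mul_one_div, ← one_div, div_le_div_iff₀ (Real.exp_pos _) hpos]
    linarith

instance muX_sigmaFinite (n : ℕ) : SigmaFinite (muX n) := by unfold muX; infer_instance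

instance muX_inv (n : ℕ) : (muX n).IsAddLeftInvariant := by unfold muX; infer_instance

instance XX_measAdd (n : ℕ) : MeasurableAdd₂ (XX n) := by infer_instance

lemma prod_shift (n : ℕ) (f : XX n × XX n → ℝ≥0∞) (hf : Measurable f) :
    ∫⁻ a, f a ∂((muX n).prod (muX n)) = ∫⁻ P, ∫⁻ k, f (k, P - k) ∂(muX n) ∂(muX n) := by
  rw [lintegral_prod _ hf.aemeasurable]
  have h1 : (∫⁻ k, ∫⁻ y, f (k, y) ∂(muX n) ∂(muX n)) = ∫⁻ k, ∫⁻ P, f (k, P - k) ∂(muX n) ∂(muX n) :=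
    lintegral_congr fun k => (lintegral_sub_right_eq_self (μ := muX n) (fun y => f (k, y)) k).symm
  rw [h1]
  exact lintegral_lintegral_swap (hf.comp (by fun_prop)).aemeasurable

lemma gauss_lint (v : ℝ≥0) (hv : 0 < v) (s₀ : ℝ) :
    ∫⁻ s : ℝ, ENNReal.ofReal (Real.exp (-(v * (s - s₀) ^ 2 / 2))) = ENNReal.ofReal √(2 * Real.pi / v) := by
  rw [lintegral_sub_right_eq_self (μ := volume) (fun s : ℝ => ENNReal.ofReal (Real.exp (-(v * s ^ 2 / 2)))) s₀]
  have hv' : (0 : ℝ) < v := hv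
  have e : ∀ s : ℝ, Real.exp (-(v * s ^ 2 / 2)) = Real.exp (-(v / 2 : ℝ) * s ^ 2) := by intro s; congr 1; ring
  simp_rw [e]
  rw [← ofReal_integral_eq_lintegral_ofReal (integrable_exp_neg_mul_sq (by positivity)) (Filter.Eventually.of_forall fun s => (Real.exp_pos _).le)]
  rw [integral_gaussian]
  congr 2
  field_simp


def hP (n : ℕ) (v : ℝ≥0) (b : XX n × XX n) (P : XX n) : ℝ≥0∞ :=
  ENNReal.ofReal (Real.exp (-(v * (P.1 - (b.1.1 + b.2.1)) ^ 2 / 2))) *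
    if P.2 = b.1.2 + b.2.2 then ENNReal.ofReal (2 * Real.pi) ^ n else 0

lemma hP_meas (n : ℕ) (v : ℝ≥0) (b : XX n × XX n) : Measurable (hP n v b) := by
  unfold hP
  refine Measurable.mul (by fun_prop) (Measurable.ite ?_ measurable_const measurable_const)
  exact measurableSet_eq_fun (by fun_prop) (by fun_prop)

lemma hP_int (n : ℕ) (v : ℝ≥0) (hv : 0 < v) (b : XX n × XX n) : ∫⁻ P, hP n v b P ∂(muX n) =
    ENNReal.ofReal √(2 * Real.pi / v) * ENNReal.ofReal (2 * Real.pi) ^ n := by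
  unfold muX hP
  rw [lintegral_prod_mul (f := fun s : ℝ => ENNReal.ofReal (Real.exp (-(v * (s - (b.1.1 + b.2.1)) ^ 2 / 2))))
      (g := fun m : Fin n → ℤ => if m = b.1.2 + b.2.2 then ENNReal.ofReal (2 * Real.pi) ^ n else 0) (by fun_prop)
      (measurable_of_countable _).aemeasurable, gauss_lint v hv, lintegral_count, tsum_ite_eq]

lemma ker_inner (n : ℕ) (c : ℤ → ℝ≥0∞) (hexp : ∀ s : ℝ, ∀ l : ℤ, (l : ℝ) ≤ s → s ≤ l + 1 →
    ENNReal.ofReal (Real.exp (-s ^ 2 / 2)) ≤ c l) (N₁ N₂ : ℝ) (v : ℝ≥0) (b : XX n × XX n) (B : ℝ≥0∞)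
    (hB : ∀ P τ, muX n (Res n N₁ N₂ P τ) ≤ B) (P : XX n) :
    ∫⁻ k, (SS n N₁ ×ˢ SS n N₂).indicator (fun a => kerK n v a b) (k, P - k) ∂(muX n) ≤
      (∑' l, c l) * B * hP n v b P := by
  have pt : ∀ k, (SS n N₁ ×ˢ SS n N₂).indicator (fun a => kerK n v a b) (k, P - k) ≤
      (∑' l : ℤ, c l * (Res n N₁ N₂ P ((nsq b.1 + nsq b.2) + l)).indicator 1 k) * hP n v b P := by
    intro k
    by_cases hk : (k, P - k) ∈ SS n N₁ ×ˢ SS n N₂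
    · rw [Set.indicator_of_mem hk]
      unfold kerK hP
      have e1 : k.1 + (P - k).1 = P.1 := by simp
      have e2 : k.2 + (P - k).2 = P.2 := by simp
      simp only [e1, e2]
      refine mul_le_mul_left ?_ _
      generalize hs : (nsq k + nsq (P - k)) - (nsq b.1 + nsq b.2) = s
      refine le_trans ?_ (ENNReal.le_tsum ⌊s⌋)
      have f1 := Int.floor_le s
      have f2 := (Int.lt_floor_add_one s).le
      have hmem : k ∈ Res n N₁ N₂ P ((nsq b.1 + nsq b.2) + (⌊s⌋ : ℝ)) := by
        refine ⟨hk.1, hk.2, ?_, ?_⟩ <;> linarith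
      rw [Set.indicator_of_mem hmem, Pi.one_apply, mul_one]
      exact hexp s ⌊s⌋ f1 f2
    · rw [Set.indicator_of_notMem hk]; exact bot_le
  refine (lintegral_mono pt).trans ?_
  have hind : ∀ l : ℤ, Measurable (fun k => c l * (Res n N₁ N₂ P ((nsq b.1 + nsq b.2) + l)).indicator (1 : XX n → ℝ≥0∞) k) :=
    fun l => (measurable_one.indicator (measurableSet_Res n N₁ N₂ P _)).const_mul _
  rw [lintegral_mul_const _ (Measurable.tsum hind), lintegral_tsum fun l => (hind l).aemeasurable]
  refine mul_le_mul_left ?_ _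
  rw [← ENNReal.tsum_mul_right]
  refine ENNReal.tsum_le_tsum fun l => ?_
  rw [lintegral_const_mul _ (measurable_one.indicator (measurableSet_Res n N₁ N₂ P _)),
    lintegral_indicator_one (measurableSet_Res n N₁ N₂ P _)]
  exact mul_le_mul_right (hB P _) _

lemma schur_int (n : ℕ) (hn : 2 ≤ n) : ∃ C : ℝ, 0 < C ∧ ∀ (M : ℕ) (N₁ : ℝ) (v : ℝ≥0) (b : XX n × XX n),
    1 ≤ M → (M : ℝ) ≤ N₁ → 0 < v →
    ∫⁻ a in SS n N₁ ×ˢ SS n M, kerK n v a b ∂((muX n).prod (muX n)) ≤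
      ENNReal.ofReal (C * (M : ℝ) ^ (n - 1) * Eg N₁ M) * ENNReal.ofReal √(2 * Real.pi / v) := by
  obtain ⟨C₀, hC₀, hcount⟩ := count_bound n hn
  obtain ⟨c, hc, hexp⟩ := exp_sum_bound
  have hT0 : 0 ≤ (∑' l, c l).toReal := ENNReal.toReal_nonneg
  refine ⟨C₀ * ((∑' l, c l).toReal + 1) * (2 * Real.pi) ^ n, by positivity, ?_⟩
  intro M N₁ v b hM hMN hv
  have hEg : 0 < Eg N₁ M := Eg_pos (by exact_mod_cast hM) hMN
  have hSm : MeasurableSet (SS n N₁ ×ˢ SS n (M : ℝ)) := (measurableSet_SS n N₁).prod (measurableSet_SS n M)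
  have hkm : Measurable (fun a => kerK n v a b) := (measurable_kerK n v).of_uncurry_right
  rw [← lintegral_indicator hSm, prod_shift n _ (hkm.indicator hSm)]
  refine (lintegral_mono (ker_inner n c hexp N₁ M v b _ (fun P τ => hcount M N₁ P τ hM hMN))).trans ?_
  rw [lintegral_const_mul _ (hP_meas n v b), hP_int n v hv b]
  generalize hT : (∑' l, c l) = T at *
  have hTT : T ≤ ENNReal.ofReal (T.toReal + 1) := by
    conv_lhs => rw [← ENNReal.ofReal_toReal hc]
    exact ENNReal.ofReal_le_ofReal (by linarith)
  refine le_trans (mul_le_mul_left (mul_le_mul_left hTT _) _) (le_of_eq ?_)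
  have hpi : 0 < 2 * Real.pi := by positivity
  have hMp : (0 : ℝ) ≤ (M : ℝ) ^ (n - 1) := by positivity
  rw [← ENNReal.ofReal_pow hpi.le, ← ENNReal.ofReal_mul (by linarith), ← ENNReal.ofReal_mul (Real.sqrt_nonneg _),
        ← ENNReal.ofReal_mul (by positivity), ← ENNReal.ofReal_mul (by positivity)]
  congr 1; ring


def wv {n : ℕ} (f : XX n → ℂ) (z : ℝ × ℝ × (Fin n → ℝ)) : ℂ :=
  ∫ k, f k * Complex.exp (((z.2.1 * k.1 + ∑ i, z.2.2 i * ((k.2 i : ℤ) : ℝ) - z.1 * nsq k : ℝ) : ℂ) * Complex.I) ∂(muX n)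

lemma wv_mul {n : ℕ} (f₁ f₂ : XX n → ℂ) (z : ℝ × ℝ × (Fin n → ℝ)) :
    wv f₁ z * wv f₂ z = ∫ a : XX n × XX n, (f₁ a.1 * f₂ a.2) * EE a z ∂((muX n).prod (muX n)) := by
  unfold wv
  rw [← integral_prod_mul]
  refine integral_congr_ae (Filter.Eventually.of_forall fun a => ?_)
  simp only [EE]
  have hs : ∑ i, z.2.2 i * ((a.1.2 i + a.2.2 i : ℤ) : ℝ) =
      ∑ i, z.2.2 i * ((a.1.2 i : ℤ) : ℝ) + ∑ i, z.2.2 i * ((a.2.2 i : ℤ) : ℝ) := by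
    rw [← Finset.sum_add_distrib]
    refine Finset.sum_congr rfl fun i _ => ?_
    push_cast; ring
  rw [hs]
  generalize ∑ i, z.2.2 i * ((a.1.2 i : ℤ) : ℝ) = A
  generalize ∑ i, z.2.2 i * ((a.2.2 i : ℤ) : ℝ) = B
  have : Complex.exp (((z.2.1 * (a.1.1 + a.2.1) + (A + B) - z.1 * (nsq a.1 + nsq a.2) : ℝ) : ℂ) * Complex.I) =
      Complex.exp (((z.2.1 * a.1.1 + A - z.1 * nsq a.1 : ℝ) : ℂ) * Complex.I) *
      Complex.exp (((z.2.1 * a.2.1 + B - z.1 * nsq a.2 : ℝ) : ℂ) * Complex.I) := by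
    rw [← Complex.exp_add]; congr 1; push_cast; ring
  rw [this]; ring

lemma main_rho (n : ℕ) (hn : 2 ≤ n) : ∃ C : ℝ, 0 < C ∧ ∀ (M : ℕ) (N₁ : ℝ) (v : ℝ≥0) (f₁ f₂ : XX n → ℂ),
    1 ≤ M → (M : ℝ) ≤ N₁ → 0 < v → Measurable f₁ → Measurable f₂ → Integrable f₁ (muX n) → Integrable f₂ (muX n) →
    (∀ k, f₁ k ≠ 0 → k ∈ SS n N₁) → (∀ k, f₂ k ≠ 0 → k ∈ SS n M) →
    ∫⁻ z, ‖wv f₁ z * wv f₂ z‖ₑ ^ 2 ∂(rhoZ n v) ≤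
      ENNReal.ofReal (C * (M : ℝ) ^ (n - 1) * Eg N₁ M) * ENNReal.ofReal √(2 * Real.pi / v) *
      ((∫⁻ k, ‖f₁ k‖ₑ ^ 2 ∂(muX n)) * ∫⁻ k, ‖f₂ k‖ₑ ^ 2 ∂(muX n)) := by
  obtain ⟨C, hC, h⟩ := schur_int n hn
  refine ⟨C, hC, ?_⟩
  intro M N₁ v f₁ f₂ hM hMN hv m₁ m₂ i₁ i₂ s₁ s₂
  simp_rw [wv_mul]
  have hGm : Measurable (fun a : XX n × XX n => f₁ a.1 * f₂ a.2) :=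
    (m₁.comp measurable_fst).mul (m₂.comp measurable_snd)
  have := schur_TT ((muX n).prod (muX n)) (rhoZ n v) EE (measurable_EE n) EE_norm
    (fun a => f₁ a.1 * f₂ a.2) hGm (i₁.mul_prod i₂) (SS n N₁ ×ˢ SS n (M : ℝ))
    ((measurableSet_SS n N₁).prod (measurableSet_SS n M))
    (fun a ha => ⟨s₁ _ (left_ne_zero_of_mul ha), s₂ _ (right_ne_zero_of_mul ha)⟩)
    (kerK n v) (measurable_kerK n v) (kerK_symm n v) (kerK_bound n v) _ (fun b => h M N₁ v b hM hMN hv)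
  refine this.trans (le_of_eq ?_)
  congr 1
  rw [← lintegral_prod_mul (m₁.enorm.pow_const 2).aemeasurable (m₂.enorm.pow_const 2).aemeasurable]
  refine lintegral_congr fun a => ?_
  rw [enorm_mul, mul_pow]

lemma measurable_wv {n : ℕ} (f : XX n → ℂ) (hf : Measurable f) : Measurable (wv f) := by
  unfold wv
  have hz : Measurable (fun k : ℤ => (k : ℝ)) := measurable_of_countable _
  have h1 : Measurable (fun p : (ℝ × ℝ × (Fin n → ℝ)) × XX n => nsq p.2) := measurable_nsq.comp measurable_snd
  have h3 : ∀ i, Measurable (fun p : (ℝ × ℝ × (Fin n → ℝ)) × XX n => ((p.2.2 i : ℤ) : ℝ)) := by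
    intro i
    exact hz.comp (by fun_prop)
  have hm : Measurable (fun p : (ℝ × ℝ × (Fin n → ℝ)) × XX n => f p.2 * Complex.exp (((p.1.2.1 * p.2.1 +
      ∑ i, p.1.2.2 i * ((p.2.2 i : ℤ) : ℝ) - p.1.1 * nsq p.2 : ℝ) : ℂ) * Complex.I)) := by
    refine (hf.comp measurable_snd).mul ?_
    refine Complex.measurable_exp.comp (Measurable.mul_const (Complex.measurable_ofReal.comp ?_) _)
    refine Measurable.sub (Measurable.add (by fun_prop) ?_) (Measurable.mul (by fun_prop) h1)
    refine Finset.measurable_sum _ fun i _ => ?_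
    exact Measurable.mul (by fun_prop) (h3 i)
  have hi := (hm.stronglyMeasurable.integral_prod_right' (ν := muX n)).measurable
  exact hi

/-- Compare the Lebesgue measure with the Gaussian measure. -/
lemma rho_compare (n : ℕ) (v : ℝ≥0) (hv : 0 < v) (F : ℝ × ℝ × (Fin n → ℝ) → ℝ≥0∞) (hF : Measurable F) :
    ENNReal.ofReal ((√(2 * Real.pi))⁻¹ * Real.exp (-1 / 2)) * (ENNReal.ofReal (√(2 * Real.pi * v))⁻¹ *
      ∫⁻ t in Set.Icc (0 : ℝ) 1, ∫⁻ x : ℝ, ENNReal.ofReal (Real.exp (-x ^ 2 / (2 * v))) * ∫⁻ y in torusBox 1 n, F (t, x, y)) ≤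
    ∫⁻ z, F z ∂(rhoZ n v) := by
  have hH : Measurable (fun p : ℝ × ℝ => ∫⁻ y in torusBox 1 n, F (p.1, p.2, y)) := by
    apply Measurable.lintegral_prod_right' (f := fun q : (ℝ × ℝ) × (Fin n → ℝ) => F (q.1.1, q.1.2, q.2))
    exact hF.comp (by fun_prop)
  unfold rhoZ
  rw [lintegral_prod _ hF.aemeasurable]
  have e1 : ∀ t, ∫⁻ q : ℝ × (Fin n → ℝ), F (t, q) ∂((ProbabilityTheory.gaussianReal 0 v).prod (volume.restrict (torusBox 1 n))) =
      ENNReal.ofReal (√(2 * Real.pi * v))⁻¹ * ∫⁻ x : ℝ, ENNReal.ofReal (Real.exp (-x ^ 2 / (2 * v))) * ∫⁻ y in torusBox 1 n, F (t, x, y) := by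
    intro t
    have hHt : Measurable (fun x : ℝ => ∫⁻ y in torusBox 1 n, F (t, x, y)) :=
      hH.comp (by fun_prop : Measurable fun x : ℝ => (t, x))
    have hHt2 : Measurable (fun x : ℝ => ENNReal.ofReal (Real.exp (-x ^ 2 / (2 * v))) * ∫⁻ y in torusBox 1 n, F (t, x, y)) :=
      Measurable.mul (by fun_prop) hHt
    rw [lintegral_prod (fun q : ℝ × (Fin n → ℝ) => F (t, q)) (hF.comp (by fun_prop : Measurable fun q : ℝ × (Fin n → ℝ) => (t, q))).aemeasurable,
      ProbabilityTheory.gaussianReal_of_var_ne_zero _ hv.ne',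
      lintegral_withDensity_eq_lintegral_mul _ (ProbabilityTheory.measurable_gaussianPDF 0 v) hHt,
      ← lintegral_const_mul _ hHt2]
    refine lintegral_congr fun x => ?_
    simp only [Pi.mul_apply, ProbabilityTheory.gaussianPDF, ProbabilityTheory.gaussianPDFReal, sub_zero]
    rw [ENNReal.ofReal_mul (by positivity), mul_assoc]
  simp_rw [e1]
  have hK : Measurable (fun t : ℝ => ∫⁻ x : ℝ, ENNReal.ofReal (Real.exp (-x ^ 2 / (2 * v))) * ∫⁻ y in torusBox 1 n, F (t, x, y)) := by
    apply Measurable.lintegral_prod_right' (f := fun q : ℝ × ℝ => ENNReal.ofReal (Real.exp (-q.2 ^ 2 / (2 * v))) * ∫⁻ y in torusBox 1 n, F (q.1, q.2, y))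
    exact Measurable.mul (by fun_prop) hH
  rw [ProbabilityTheory.gaussianReal_of_var_ne_zero _ one_ne_zero,
      lintegral_withDensity_eq_lintegral_mul _ (ProbabilityTheory.measurable_gaussianPDF 0 1) (hK.const_mul _)]
  rw [← lintegral_const_mul _ hK, ← lintegral_const_mul _ (hK.const_mul _)]
  refine le_trans ?_ (setLIntegral_le_lintegral (Set.Icc (0 : ℝ) 1) _)
  refine setLIntegral_mono' measurableSet_Icc fun t ht => ?_
  simp only [Pi.mul_apply, ProbabilityTheory.gaussianPDF, ProbabilityTheory.gaussianPDFReal, sub_zero]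
  refine mul_le_mul_left (ENNReal.ofReal_le_ofReal ?_) _
  simp only [NNReal.coe_one, mul_one]
  refine mul_le_mul_of_nonneg_left (Real.exp_le_exp.2 ?_) (by positivity)
  have : t ^ 2 ≤ 1 := pow_le_one₀ ht.1 ht.2
  linarith

lemma weight_limit (n : ℕ) (F : ℝ × ℝ × (Fin n → ℝ) → ℝ≥0∞) (hF : Measurable F) (A : ℝ≥0∞)
    (h : ∀ v : ℝ≥0, 0 < v → ∫⁻ t in Set.Icc (0 : ℝ) 1, ∫⁻ x : ℝ, ENNReal.ofReal (Real.exp (-x ^ 2 / (2 * v))) *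
      ∫⁻ y in torusBox 1 n, F (t, x, y) ≤ A) :
    ∫⁻ t in Set.Icc (0 : ℝ) 1, ∫⁻ x : ℝ, ∫⁻ y in torusBox 1 n, F (t, x, y) ≤ A := by
  have hH : Measurable (fun p : ℝ × ℝ => ∫⁻ y in torusBox 1 n, F (p.1, p.2, y)) := by
    apply Measurable.lintegral_prod_right' (f := fun q : (ℝ × ℝ) × (Fin n → ℝ) => F (q.1.1, q.1.2, q.2))
    exact hF.comp (by fun_prop)
  rw [← lintegral_prod (fun p : ℝ × ℝ => ∫⁻ y in torusBox 1 n, F (p.1, p.2, y)) hH.aemeasurable]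
  set H : ℝ × ℝ → ℝ≥0∞ := fun p => ∫⁻ y in torusBox 1 n, F (p.1, p.2, y) with hHdef
  set w : ℕ → ℝ × ℝ → ℝ≥0∞ := fun k p => ENNReal.ofReal (Real.exp (-p.2 ^ 2 / (2 * ((k + 1 : ℝ≥0) : ℝ)))) * H p with hw
  have hwm : ∀ k, Measurable (w k) := fun k => Measurable.mul (by fun_prop) hH
  have hlim := lintegral_tendsto_of_tendsto_of_monotone (μ := (volume.restrict (Set.Icc (0 : ℝ) 1)).prod (volume : Measure ℝ))
    (f := w) (F := H) (fun k => (hwm k).aemeasurable) ?_ ?_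
  · refine le_of_tendsto' hlim fun k => ?_
    rw [lintegral_prod _ (hwm k).aemeasurable]
    exact h (k + 1 : ℝ≥0) (by positivity)
  · refine Filter.Eventually.of_forall fun p => ?_
    intro i j hij
    refine mul_le_mul_left (ENNReal.ofReal_le_ofReal (Real.exp_le_exp.2 ?_)) _
    rw [neg_div, neg_div, neg_le_neg_iff]
    push_cast
    gcongr
  · refine Filter.Eventually.of_forall fun p => ?_
    have h1 : Filter.Tendsto (fun k : ℕ => Real.exp (-p.2 ^ 2 / (2 * ((k + 1 : ℝ≥0) : ℝ)))) Filter.atTop (nhds 1) := by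
      have h0 : Filter.Tendsto (fun k : ℕ => -p.2 ^ 2 / (2 * ((k + 1 : ℝ≥0) : ℝ))) Filter.atTop (nhds 0) := by
        apply Filter.Tendsto.div_atTop tendsto_const_nhds
        refine Filter.Tendsto.const_mul_atTop (by norm_num) ?_
        push_cast
        exact Filter.tendsto_atTop_add_const_right _ _ tendsto_natCast_atTop_atTop
      have h9 := (Real.continuous_exp.tendsto 0).comp h0
      rw [Real.exp_zero] at h9
      exact h9
    have h2 := ENNReal.tendsto_ofReal h1
    rw [ENNReal.ofReal_one] at h2
    have := ENNReal.Tendsto.mul_const h2 (b := H p) (Or.inl one_ne_zero)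
    simpa [hw] using this

lemma main_red (n : ℕ) (hn : 2 ≤ n) : ∃ C : ℝ, 0 < C ∧ ∀ (M : ℕ) (N₁ : ℝ) (f₁ f₂ : XX n → ℂ),
    1 ≤ M → (M : ℝ) ≤ N₁ → Measurable f₁ → Measurable f₂ → Integrable f₁ (muX n) → Integrable f₂ (muX n) →
    (∀ k, f₁ k ≠ 0 → k ∈ SS n N₁) → (∀ k, f₂ k ≠ 0 → k ∈ SS n M) →
    ∫⁻ t in Set.Icc (0 : ℝ) 1, ∫⁻ x : ℝ, ∫⁻ y in torusBox 1 n, ‖wv f₁ (t, x, y) * wv f₂ (t, x, y)‖ₑ ^ 2 ≤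
      ENNReal.ofReal (C * (M : ℝ) ^ (n - 1) * Eg N₁ M) *
      ((∫⁻ k, ‖f₁ k‖ₑ ^ 2 ∂(muX n)) * ∫⁻ k, ‖f₂ k‖ₑ ^ 2 ∂(muX n)) := by
  obtain ⟨C, hC, h⟩ := main_rho n hn
  set c₁ : ℝ := (√(2 * Real.pi))⁻¹ * Real.exp (-1 / 2) with hc₁
  have hc₁p : 0 < c₁ := by positivity
  refine ⟨c₁⁻¹ * (2 * Real.pi) * C, by positivity, ?_⟩
  intro M N₁ f₁ f₂ hM hMN m₁ m₂ i₁ i₂ s₁ s₂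
  have hEg : 0 < Eg N₁ M := Eg_pos (by exact_mod_cast hM) hMN
  have hFm : Measurable (fun z => ‖wv f₁ z * wv f₂ z‖ₑ ^ 2) :=
    ((measurable_wv f₁ m₁).mul (measurable_wv f₂ m₂)).enorm.pow_const 2
  refine weight_limit n (fun z => ‖wv f₁ z * wv f₂ z‖ₑ ^ 2) hFm _ fun v hv => ?_
  have h1 := (rho_compare n v hv _ hFm).trans (h M N₁ v f₁ f₂ hM hMN hv m₁ m₂ i₁ i₂ s₁ s₂)
  rw [← hc₁] at h1
  generalize (∫⁻ t in Set.Icc (0 : ℝ) 1, ∫⁻ x : ℝ, ENNReal.ofReal (Real.exp (-x ^ 2 / (2 * v))) *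
      ∫⁻ y in torusBox 1 n, ‖wv f₁ (t, x, y) * wv f₂ (t, x, y)‖ₑ ^ 2) = I at h1 ⊢
  generalize ((∫⁻ k, ‖f₁ k‖ₑ ^ 2 ∂(muX n)) * ∫⁻ k, ‖f₂ k‖ₑ ^ 2 ∂(muX n)) = Q at h1 ⊢
  have hv' : (0 : ℝ) < v := hv
  set D := √(2 * Real.pi * v) with hD
  have hDp : 0 < D := by positivity
  have hDD : D * √(2 * Real.pi / v) = 2 * Real.pi := by
    rw [hD, ← Real.sqrt_mul (by positivity), show 2 * Real.pi * v * (2 * Real.pi / v) = (2 * Real.pi) ^ 2 by field_simp,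
      Real.sqrt_sq (by positivity)]
  have h2 : I = ENNReal.ofReal (c₁⁻¹ * D) * (ENNReal.ofReal c₁ * (ENNReal.ofReal D⁻¹ * I)) := by
    rw [← mul_assoc, ← mul_assoc, ← ENNReal.ofReal_mul (by positivity), ← ENNReal.ofReal_mul (by positivity)]
    rw [show c₁⁻¹ * D * c₁ * D⁻¹ = 1 by field_simp]; simp
  rw [h2]
  refine (mul_le_mul_right h1 _).trans (le_of_eq ?_)
  have hMp : (0 : ℝ) ≤ (M : ℝ) ^ (n - 1) := by positivity
  rw [← mul_assoc, ← ENNReal.ofReal_mul (by positivity), ← ENNReal.ofReal_mul (by positivity)]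
  congr 2
  calc _ = c₁⁻¹ * (D * √(2 * Real.pi / v)) * (C * (M : ℝ) ^ (n - 1) * Eg N₁ M) := by ring
    _ = _ := by rw [hDD]; ring


def gj {n : ℕ} (g : (Fin 1 → ℝ) → (Fin n → ℤ) → ℂ) (j : Fin n → ℤ) (s : ℝ) : ℂ := g (fun _ => s) j

def hj {n : ℕ} (g : (Fin 1 → ℝ) → (Fin n → ℤ) → ℂ) (j : Fin n → ℤ) : ℝ → ℂ :=
  if h : AEStronglyMeasurable (gj g j) (volume : Measure ℝ) then h.mk (gj g j) else 0

def fred {n : ℕ} (g : (Fin 1 → ℝ) → (Fin n → ℤ) → ℂ) (N : ℝ) (k : XX n) : ℂ :=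
  (SS n N).indicator (fun k => hj g k.2 k.1) k

lemma hj_meas {n : ℕ} (g : (Fin 1 → ℝ) → (Fin n → ℤ) → ℂ) (j : Fin n → ℤ) : Measurable (hj g j) := by
  unfold hj
  split_ifs with h
  · exact h.stronglyMeasurable_mk.measurable
  · exact measurable_zero

lemma fred_meas {n : ℕ} (g : (Fin 1 → ℝ) → (Fin n → ℤ) → ℂ) (N : ℝ) : Measurable (fred g N) := by
  refine Measurable.indicator ?_ (measurableSet_SS n N)
  exact measurable_from_prod_countable_left fun j => hj_meas g j

lemma fred_supp {n : ℕ} (g : (Fin 1 → ℝ) → (Fin n → ℤ) → ℂ) (N : ℝ) (k : XX n) (h : fred g N k ≠ 0) : k ∈ SS n N := by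
  by_contra hk
  exact h (Set.indicator_of_notMem hk _)

lemma supp_SS {n : ℕ} (g : (Fin 1 → ℝ) → (Fin n → ℤ) → ℂ) (N : ℝ) (hN : 1 ≤ N) (hg : SuppIn 1 g N)
    (j : Fin n → ℤ) (s : ℝ) (h : gj g j s ≠ 0) : (s, j) ∈ SS n N := by
  obtain ⟨h1, h2⟩ := hg _ _ h
  have e : freqNorm 1 (fun _ : Fin 1 => s) j = √(nsq ((s, j) : XX n)) := by
    simp [freqNorm, nsq]
  have h0 : 0 ≤ nsq ((s, j) : XX n) := by unfold nsq; positivity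
  rw [e] at h1 h2
  have hsq := Real.sq_sqrt h0
  have hs0 := Real.sqrt_nonneg (nsq ((s, j) : XX n))
  refine ⟨?_, fun hN1 => ?_⟩
  · nlinarith
  · have := h2 hN1
    nlinarith

lemma fred_ae {n : ℕ} (g : (Fin 1 → ℝ) → (Fin n → ℤ) → ℂ) (N : ℝ) (hN : 1 ≤ N) (hg : SuppIn 1 g N)
    (j : Fin n → ℤ) (h : AEStronglyMeasurable (gj g j) (volume : Measure ℝ)) :
    gj g j =ᵐ[volume] fun s => fred g N (s, j) := by
  filter_upwards [h.ae_eq_mk] with s hs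
  by_cases hk : ((s, j) : XX n) ∈ SS n N
  · rw [fred, Set.indicator_of_mem hk]
    simp only [hj, dif_pos h]
    exact hs
  · rw [fred, Set.indicator_of_notMem hk]
    by_contra h0
    exact hk (supp_SS g N hN hg j s h0)

lemma fred_zero {n : ℕ} (g : (Fin 1 → ℝ) → (Fin n → ℤ) → ℂ) (N : ℝ)
    (j : Fin n → ℤ) (h : ¬ AEStronglyMeasurable (gj g j) (volume : Measure ℝ)) (s : ℝ) :
    fred g N (s, j) = 0 := by
  unfold fred hj
  rw [Set.indicator_apply]
  simp [h]

lemma mp1 : MeasurePreserving (fun x : Fin 1 → ℝ => x 0) volume volume :=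
  volume_preserving_funUnique (Fin 1) ℝ

lemma me1 : MeasurableEmbedding (fun x : Fin 1 → ℝ => x 0) :=
  (MeasurableEquiv.funUnique (Fin 1) ℝ).measurableEmbedding

lemma fun1 (x : Fin 1 → ℝ) : (fun _ => x 0) = x := by
  funext i; congr 1; exact (Subsingleton.elim _ _)

lemma fred_l2 {n : ℕ} (g : (Fin 1 → ℝ) → (Fin n → ℤ) → ℂ) (N : ℝ) (hN : 1 ≤ N) (hg : SuppIn 1 g N) :
    ∫⁻ k, ‖fred g N k‖ₑ ^ 2 ∂(muX n) ≤ l2sq 1 g := by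
  have hm : Measurable (fun k => ‖fred g N k‖ₑ ^ 2) := (fred_meas g N).enorm.pow_const 2
  unfold muX l2sq
  rw [lintegral_prod_symm' _ hm, lintegral_count]
  simp only [one_pow, div_one, ENNReal.ofReal_one, one_mul]
  refine ENNReal.tsum_le_tsum fun j => ?_
  have e : ∫⁻ ζ : Fin 1 → ℝ, (‖g ζ j‖₊ : ℝ≥0∞) ^ 2 = ∫⁻ s, ‖gj g j s‖ₑ ^ 2 := by
    rw [← mp1.lintegral_comp_emb me1]
    refine lintegral_congr fun ζ => ?_
    rw [gj, fun1]; rfl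
  rw [e]
  by_cases h : AEStronglyMeasurable (gj g j) (volume : Measure ℝ)
  · refine le_of_eq (lintegral_congr_ae ?_)
    filter_upwards [fred_ae g N hN hg j h] with s hs
    rw [hs]
  · simp [fred_zero g N j h]

lemma SS_finite (n : ℕ) (N : ℝ) (hN : 0 ≤ N) : muX n (SS n N) < ∞ := by
  have hsub : SS n N ⊆ Set.Icc (-(2 * N)) (2 * N) ×ˢ
      (((Fintype.piFinset fun _ : Fin n => Finset.Icc (-⌈2 * N⌉) ⌈2 * N⌉) : Finset (Fin n → ℤ)) : Set (Fin n → ℤ)) := by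
    intro k hk
    obtain ⟨h1, h2⟩ := coord_le hN hk
    refine ⟨abs_le.1 h1, ?_⟩
    simp only [Finset.mem_coe, Fintype.mem_piFinset, Finset.mem_Icc]
    intro i
    have h3 := (abs_le.1 (h2 i))
    have h4 := Int.le_ceil (2 * N)
    constructor
    · have : (-(⌈2 * N⌉ : ℤ) : ℝ) ≤ (k.2 i : ℝ) := by linarith [h3.1]
      exact_mod_cast this
    · have : ((k.2 i : ℤ) : ℝ) ≤ (⌈2 * N⌉ : ℝ) := by linarith [h3.2]
      exact_mod_cast this
  refine (measure_mono hsub).trans_lt ?_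
  unfold muX
  rw [Measure.prod_prod, Measure.count_apply_finset, Real.volume_Icc]
  exact ENNReal.mul_lt_top ENNReal.ofReal_lt_top (ENNReal.natCast_lt_top _)

lemma fred_integrable {n : ℕ} (g : (Fin 1 → ℝ) → (Fin n → ℤ) → ℂ) (N : ℝ) (hN : 1 ≤ N)
    (h2 : ∫⁻ k, ‖fred g N k‖ₑ ^ 2 ∂(muX n) ≠ ∞) : Integrable (fred g N) (muX n) := by
  refine ⟨(fred_meas g N).aestronglyMeasurable, ?_⟩
  have pt : ∀ k, ‖fred g N k‖ₑ ≤ (SS n N).indicator 1 k + ‖fred g N k‖ₑ ^ 2 := by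
    intro k
    by_cases hk : k ∈ SS n N
    · rw [Set.indicator_of_mem hk, Pi.one_apply]
      rcases le_total ‖fred g N k‖ₑ 1 with h | h
      · exact h.trans le_self_add
      · refine le_trans ?_ le_add_self
        rw [sq]
        exact le_mul_of_one_le_left' h
    · have : fred g N k = 0 := Set.indicator_of_notMem hk _
      simp [this]
  refine (lintegral_mono pt).trans_lt ?_
  rw [lintegral_add_left (measurable_one.indicator (measurableSet_SS n N)), lintegral_indicator_one (measurableSet_SS n N)]
  exact ENNReal.add_lt_top.2 ⟨SS_finite n N (by linarith), h2.lt_top⟩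

lemma fred_wave {n : ℕ} (g : (Fin 1 → ℝ) → (Fin n → ℤ) → ℂ) (N : ℝ) (hN : 1 ≤ N) (hg : SuppIn 1 g N)
    (h2 : ∫⁻ k, ‖fred g N k‖ₑ ^ 2 ∂(muX n) ≠ ∞) (t : ℝ) (x : Fin 1 → ℝ) (y : Fin n → ℝ) :
    waveU 1 g t x y = wv (fred g N) (t, x 0, y) := by
  have hIntg := fred_integrable g N hN h2
  set ph : XX n → ℂ := fun k => Complex.exp (((x 0 * k.1 + ∑ i, y i * ((k.2 i : ℤ) : ℝ) - t * nsq k : ℝ) : ℂ) * Complex.I) with hph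
  have hphm : ∀ j, Measurable (fun s : ℝ => ph (s, j)) := by
    intro j
    simp only [hph, nsq]
    fun_prop
  have hphm2 : Measurable ph := measurable_from_prod_countable_left fun j => hphm j
  have hfp : Integrable (fun k => fred g N k * ph k) (muX n) := by
    refine hIntg.norm.mono' ((fred_meas g N).mul hphm2).aestronglyMeasurable (Filter.Eventually.of_forall fun k => ?_)
    rw [norm_mul, hph, Complex.norm_exp_ofReal_mul_I, mul_one]
  have e1 : wv (fred g N) (t, x 0, y) = ∑' j : Fin n → ℤ, ∫ s : ℝ, fred g N (s, j) * ph (s, j) := by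
    have e0 : wv (fred g N) (t, x 0, y) = ∫ k, fred g N k * ph k ∂(muX n) := rfl
    rw [e0]
    unfold muX at hfp ⊢
    rw [integral_prod_symm _ hfp, integral_countable hfp.integral_prod_right]
    refine tsum_congr fun j => ?_
    simp [Measure.real]
  rw [e1, waveU]
  simp only [one_pow, div_one, Complex.ofReal_one, one_mul]
  refine tsum_congr fun j => ?_
  have e2 : (∫ ζ : Fin 1 → ℝ, g ζ j * Complex.exp (Complex.I *
      ((((∑ i, x i * ζ i) + ∑ i, y i * (j i : ℝ)) - t * ((∑ i, (ζ i) ^ 2) + ∑ i, (j i : ℝ) ^ 2) : ℝ) : ℂ))) =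
      ∫ s : ℝ, gj g j s * ph (s, j) := by
    rw [← mp1.integral_comp me1]
    refine integral_congr_ae (Filter.Eventually.of_forall fun ζ => ?_)
    simp only [gj, fun1, hph, nsq]
    congr 1
    simp [mul_comm]
  rw [e2]
  by_cases h : AEStronglyMeasurable (gj g j) (volume : Measure ℝ)
  · refine integral_congr_ae ?_
    filter_upwards [fred_ae g N hN hg j h] with s hs
    rw [hs]
  · have hz : ∀ s, fred g N (s, j) * ph (s, j) = 0 := fun s => by rw [fred_zero g N j h s, zero_mul]
    simp only [hz, integral_zero]
    apply integral_non_aestronglyMeasurable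
    intro hc
    apply h
    have := hc.mul ((hphm j).inv.aestronglyMeasurable (μ := volume))
    refine this.congr (Filter.Eventually.of_forall fun s => ?_)
    have hne : ph (s, j) ≠ 0 := Complex.exp_ne_zero _
    simp only [Pi.mul_apply, Pi.inv_apply]
    field_simp

lemma wv_zero {n : ℕ} (f : XX n → ℂ) (hf : Measurable f) (h : ∫⁻ k, ‖f k‖ₑ ^ 2 ∂(muX n) = 0)
    (z : ℝ × ℝ × (Fin n → ℝ)) : wv f z = 0 := by
  rw [lintegral_eq_zero_iff (hf.enorm.pow_const 2)] at h
  unfold wv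
  refine integral_eq_zero_of_ae ?_
  filter_upwards [h] with k hk
  have : f k = 0 := by simpa using hk
  simp [this]

lemma main_sq (n : ℕ) (hn : 2 ≤ n) : ∃ C : ℝ, 0 < C ∧ ∀ (M : ℕ) (N₁ : ℝ) (g₁ g₂ : (Fin 1 → ℝ) → (Fin n → ℤ) → ℂ),
    1 ≤ M → (M : ℝ) ≤ N₁ → SuppIn 1 g₁ N₁ → SuppIn 1 g₂ M →
    ∫⁻ t in Set.Icc (0 : ℝ) 1, ∫⁻ x : Fin 1 → ℝ, ∫⁻ y in torusBox 1 n,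
          (‖waveU 1 g₁ t x y * waveU 1 g₂ t x y‖₊ : ℝ≥0∞) ^ 2 ≤
      ENNReal.ofReal (C * (M : ℝ) ^ (n - 1) * Eg N₁ M) * (l2sq 1 g₁ * l2sq 1 g₂) := by
  obtain ⟨C, hC, h⟩ := main_red n hn
  refine ⟨C, hC, ?_⟩
  intro M N₁ g₁ g₂ hM hMN hs₁ hs₂
  have hM1 : (1 : ℝ) ≤ M := by exact_mod_cast hM
  have hN1 : 1 ≤ N₁ := hM1.trans hMN
  have l₁ := fred_l2 g₁ N₁ hN1 hs₁
  have l₂ := fred_l2 g₂ M hM1 hs₂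
  have hEg : 0 < Eg N₁ M := Eg_pos hM1 hMN
  have hA : ENNReal.ofReal (C * (M : ℝ) ^ (n - 1) * Eg N₁ M) ≠ 0 := by
    have : 0 < C * (M : ℝ) ^ (n - 1) * Eg N₁ M := by positivity
    simpa using this
  rcases eq_or_ne (∫⁻ k, ‖fred g₁ N₁ k‖ₑ ^ 2 ∂(muX n)) 0 with z₁ | z₁
  · have : ∀ t x y, waveU 1 g₁ t x y = 0 := fun t x y => by
      rw [fred_wave g₁ N₁ hN1 hs₁ (by rw [z₁]; exact ENNReal.zero_ne_top), wv_zero _ (fred_meas g₁ N₁) z₁]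
    simp [this]
  rcases eq_or_ne (∫⁻ k, ‖fred g₂ M k‖ₑ ^ 2 ∂(muX n)) 0 with z₂ | z₂
  · have : ∀ t x y, waveU 1 g₂ t x y = 0 := fun t x y => by
      rw [fred_wave g₂ M hM1 hs₂ (by rw [z₂]; exact ENNReal.zero_ne_top), wv_zero _ (fred_meas g₂ M) z₂]
    simp [this]
  have p₁ : l2sq 1 g₁ ≠ 0 := fun h0 => z₁ (le_antisymm (l₁.trans h0.le) bot_le)
  have p₂ : l2sq 1 g₂ ≠ 0 := fun h0 => z₂ (le_antisymm (l₂.trans h0.le) bot_le)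
  rcases eq_or_ne (l2sq 1 g₁) ∞ with t₁ | t₁
  · rw [t₁, ENNReal.top_mul p₂, ENNReal.mul_top hA]; exact le_top
  rcases eq_or_ne (l2sq 1 g₂) ∞ with t₂ | t₂
  · rw [t₂, ENNReal.mul_top p₁, ENNReal.mul_top hA]; exact le_top
  have f₁ := ne_top_of_le_ne_top t₁ l₁
  have f₂ := ne_top_of_le_ne_top t₂ l₂
  have key := h M N₁ (fred g₁ N₁) (fred g₂ M) hM hMN (fred_meas g₁ N₁) (fred_meas g₂ M)
    (fred_integrable g₁ N₁ hN1 f₁) (fred_integrable g₂ M hM1 f₂) (fred_supp g₁ N₁) (fred_supp g₂ M)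
  refine le_trans (le_of_eq ?_) (key.trans (mul_le_mul_right (mul_le_mul' l₁ l₂) _))
  refine lintegral_congr fun t => ?_
  rw [← mp1.lintegral_comp_emb me1]
  refine lintegral_congr fun x => ?_
  refine lintegral_congr fun y => ?_
  rw [fred_wave g₁ N₁ hN1 hs₁ f₁, fred_wave g₂ M hM1 hs₂ f₂]
  rfl

/-- **Local-in-time bilinear Strichartz estimate on `ℝ × 𝕋ⁿ`, `n ≥ 2`.** -/
theorem local_bilinear_estimate_waveguide (n : ℕ) (hn : 2 ≤ n) :
    ∃ δ C : ℝ, 0 < δ ∧ 0 < C ∧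
    ∀ (N₁ N₂ : ℝ) (g₁ g₂ : (Fin 1 → ℝ) → (Fin n → ℤ) → ℂ),
      IsDyadic N₁ → IsDyadic N₂ → N₂ ≤ N₁ → 1 ≤ N₂ →
      SuppIn 1 g₁ N₁ → SuppIn 1 g₂ N₂ →
      (∫⁻ t in Set.Icc (0 : ℝ) 1, ∫⁻ x : Fin 1 → ℝ, ∫⁻ y in torusBox 1 n,
          (‖waveU 1 g₁ t x y * waveU 1 g₂ t x y‖₊ : ℝ≥0∞) ^ 2) ^ (1 / 2 : ℝ)
        ≤ ENNReal.ofReal (C * (1 / N₂ + N₂ / N₁) ^ δ * N₂ ^ (((n : ℝ) - 1) / 2))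
            * (l2sq 1 g₁) ^ (1 / 2 : ℝ) * (l2sq 1 g₂) ^ (1 / 2 : ℝ) := by
  obtain ⟨C, hC, h⟩ := main_sq n hn
  refine ⟨1 / 12, C ^ (1 / 2 : ℝ), by norm_num, by positivity, ?_⟩
  intro N₁ N₂ g₁ g₂ _ hN2 hle h1 hs₁ hs₂
  obtain ⟨a, rfl⟩ := hN2
  have hcast : ((2 ^ a : ℕ) : ℝ) = (2 : ℝ) ^ a := by push_cast; rfl
  rw [← hcast] at hle h1 hs₂ ⊢
  generalize (2 ^ a : ℕ) = M at hle h1 hs₂ ⊢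
  have hM : 1 ≤ M := by exact_mod_cast h1
  have key := ENNReal.rpow_le_rpow (h M N₁ g₁ g₂ hM hle hs₁ hs₂) (by norm_num : (0 : ℝ) ≤ 1 / 2)
  refine key.trans (le_of_eq ?_)
  have hMp : (0 : ℝ) < M := by linarith
  have hX : 0 < 1 / (M : ℝ) + M / N₁ := by
    have : 0 < N₁ := by linarith
    positivity
  have hEg : 0 < Eg N₁ M := Eg_pos h1 hle
  rw [ENNReal.mul_rpow_of_nonneg _ _ (by norm_num), ENNReal.mul_rpow_of_nonneg _ _ (by norm_num), ← mul_assoc,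
    ENNReal.ofReal_rpow_of_nonneg (by positivity) (by norm_num)]
  congr 3
  rw [Real.mul_rpow (by positivity) hEg.le, Real.mul_rpow hC.le (by positivity)]
  have e1 : Eg N₁ M ^ (1 / 2 : ℝ) = (1 / (M : ℝ) + M / N₁) ^ (1 / 12 : ℝ) := by
    rw [Eg, ← Real.rpow_mul hX.le]; norm_num
  have e2 : ((M : ℝ) ^ (n - 1)) ^ (1 / 2 : ℝ) = (M : ℝ) ^ (((n : ℝ) - 1) / 2) := by
    rw [← Real.rpow_natCast, ← Real.rpow_mul hMp.le, Nat.cast_sub (by omega)]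
    congr 1; push_cast; ring
  rw [e1, e2]; ring
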